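/- arXiv:2002.09733 — 3 statements merged into one kernel-verified Lean document; each statement's English description precedes it below -/
import Mathlib

section
/- Fix ν ∈ (0,1), T > 0 and L > 0. Let y : [0,T] → ℝ be three times continuously differentiable, let f : [0,T] × ℝ → ℝ satisfy |f(x,u) − f(x,v)| ≤ L·|u − v| for all x ∈ [0,T] and u, v ∈ ℝ, and suppose the Caputo fractional differential equation (D^ν y)(x) = f(x, y(x)) holds for all x ∈ (0,T]. Then there exists a constant K > 0 (depending on ν, L, T and y) such that: for every positive integer N with Δx = T/(2N) satisfying Δx^ν ≤ 1/(216·L), every sequence (y_j)_{j=0}^{2N} with y_0 = y(0) that solves the numerical scheme satisfies |y(x_k) − y_k| ≤ K·Δx^{3−ν} for all k = 1, 2, …, 2N. -/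
open Real Finset

noncomputable section

/-- α₀ = (ν+2)/(2^ν·Γ(3−ν)). -/
def alpha0 (ν : ℝ) : ℝ := (ν + 2) / ((2 : ℝ) ^ ν * Real.Gamma (3 - ν))

/-- θ = 2ν/(2+ν). -/
def theta (ν : ℝ) : ℝ := 2 * ν / (2 + ν)

/-- The coefficients D̄_k^(m). -/
def Dbar (ν : ℝ) (m k : ℕ) : ℝ :=
  if k = 0 then
    (1 / Real.Gamma (3 - ν)) *
      (-((2 - ν) / 2) * ((2 * m : ℝ) ^ (1 - ν) + 3 * ((2 * m : ℝ) + 2) ^ (1 - ν))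
        - (2 * m : ℝ) ^ (2 - ν) + ((2 * m : ℝ) + 2) ^ (2 - ν))
  else if k % 2 = 0 then
    (1 / Real.Gamma (3 - ν)) *
      (-((2 - ν) / 2) * (((2 * m : ℝ) - 2 * (k / 2 : ℕ)) ^ (1 - ν)
          + 6 * ((2 * m : ℝ) - 2 * (k / 2 : ℕ) + 2) ^ (1 - ν)
          + ((2 * m : ℝ) - 2 * (k / 2 : ℕ) + 4) ^ (1 - ν))
        - ((2 * m : ℝ) - 2 * (k / 2 : ℕ)) ^ (2 - ν)
        + ((2 * m : ℝ) - 2 * (k / 2 : ℕ) + 4) ^ (2 - ν))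
  else
    (2 / Real.Gamma (3 - ν)) *
      ((2 - ν) * (((2 * m : ℝ) - 2 * (k / 2 : ℕ)) ^ (1 - ν)
          + ((2 * m : ℝ) - 2 * (k / 2 : ℕ) + 2) ^ (1 - ν))
        + ((2 * m : ℝ) - 2 * (k / 2 : ℕ)) ^ (2 - ν)
        - ((2 * m : ℝ) - 2 * (k / 2 : ℕ) + 2) ^ (2 - ν))

/-- The coefficients D_k^(m); for k ≥ 3 one has D_k^(m) = D̄_{k+1}^(m). -/
def Dco (ν : ℝ) (m k : ℕ) : ℝ :=
  if k = 0 then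
    (1 / Real.Gamma (3 - ν)) *
      (((2 - ν) / 2) * ((2 * m : ℝ) ^ (1 - ν) - 3 * ((2 * m : ℝ) + 1) ^ (1 - ν))
        - (2 * m : ℝ) ^ (2 - ν) + ((2 * m : ℝ) + 1) ^ (2 - ν))
  else if k = 1 then
    (1 / Real.Gamma (3 - ν)) *
      (-((2 - ν) / 2) * (((2 * m : ℝ) - 2) ^ (1 - ν) + 3 * (2 * m : ℝ) ^ (1 - ν)
          - 4 * ((2 * m : ℝ) + 1) ^ (1 - ν))
        - ((2 * m : ℝ) - 2) ^ (2 - ν) + 3 * (2 * m : ℝ) ^ (2 - ν)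
        - 2 * ((2 * m : ℝ) + 1) ^ (2 - ν))
  else if k = 2 then
    (1 / Real.Gamma (3 - ν)) *
      (((2 - ν) / 2) * (4 * ((2 * m : ℝ) - 2) ^ (1 - ν) + 3 * (2 * m : ℝ) ^ (1 - ν)
          - ((2 * m : ℝ) + 1) ^ (1 - ν))
        + 2 * ((2 * m : ℝ) - 2) ^ (2 - ν) - 3 * (2 * m : ℝ) ^ (2 - ν)
        + ((2 * m : ℝ) + 1) ^ (2 - ν))
  else Dbar ν m (k + 1)

/-- The scheme coefficients d_k^j. -/
def dco (ν : ℝ) (j k : ℕ) : ℝ :=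
  if j % 2 = 1 then -Dco ν (j / 2) k / alpha0 ν
  else -Dbar ν (j / 2 - 1) k / alpha0 ν

/-- The transformed coefficients d̄_k^j. -/
def dbarco (ν : ℝ) (j k : ℕ) : ℝ :=
  if k = j then -1
  else if j = 3 then
    if k = 2 then dco ν 3 2 - theta ν
    else if k = 1 then theta ν * (dco ν 3 2 - theta ν) + dco ν 3 1
    else theta ν * (theta ν * (dco ν 3 2 - theta ν) + dco ν 3 1) + dco ν 3 0
  else
    theta ν ^ (j - k) + ∑ k' ∈ Finset.Icc k (j - 2), dco ν j k' * theta ν ^ (k' - k)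

/-- The coefficients B̄_i^n: B̄_0^n = Δx^{−ν}α₀ and
    B̄_{n−k}^n = B̄_{n−k−1}^n − Δx^{−ν}·α₀·d̄_k^n for k = n−1,…,1. -/
def Bbar (ν Δx : ℝ) (n : ℕ) : ℕ → ℝ
  | 0 => Δx ^ (-ν) * alpha0 ν
  | i + 1 => Bbar ν Δx n i - Δx ^ (-ν) * alpha0 ν * dbarco ν n (n - (i + 1))

/-- The complementary discrete kernels P_j^n. -/
def Pker (ν Δx : ℝ) (n : ℕ) : ℕ → ℝ
  | 0 => 1 / Bbar ν Δx n 0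
  | j + 1 =>
    if n ≤ j + 3 then 0
    else (1 / Bbar ν Δx (n - (j + 1)) 0) *
      ∑ k ∈ (Finset.range (j + 1)).attach,
        (Bbar ν Δx (n - k.1) (j - k.1) - Bbar ν Δx (n - k.1) (j + 1 - k.1)) * Pker ν Δx n k.1
  decreasing_by
    have := Finset.mem_range.mp k.2; omega

/-- D̂_0, D̂_1, D̂_2, D̃_0, D̃_1, D̃_2 : first/second-step coefficients. -/
def Dhat0 (ν : ℝ) : ℝ := (3 * ν - 4) / (2 * Real.Gamma (3 - ν))
def Dhat1 (ν : ℝ) : ℝ := 2 * (1 - ν) / Real.Gamma (3 - ν)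
def Dhat2 (ν : ℝ) : ℝ := ν / (2 * Real.Gamma (3 - ν))
def Dtil0 (ν : ℝ) : ℝ := (3 * ν - 2) / ((2 : ℝ) ^ ν * Real.Gamma (3 - ν))
def Dtil1 (ν : ℝ) : ℝ := -(4 * ν) / ((2 : ℝ) ^ ν * Real.Gamma (3 - ν))
def Dtil2 (ν : ℝ) : ℝ := (ν + 2) / ((2 : ℝ) ^ ν * Real.Gamma (3 - ν))

/-- The Caputo fractional derivative of order ν. -/
def caputo (ν : ℝ) (y : ℝ → ℝ) (x : ℝ) : ℝ :=
  (1 / Real.Gamma (1 - ν)) * ∫ s in (0:ℝ)..x, (x - s) ^ (-ν) * deriv y s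

/-- The discrete Caputo derivative of a function y at the grid point x_j = jΔx. -/
def discCaputo (ν Δx : ℝ) (y : ℝ → ℝ) (j : ℕ) : ℝ :=
  if j = 1 then
    Δx ^ (-ν) * (Dhat0 ν * y 0 + Dhat1 ν * y Δx + Dhat2 ν * y (2 * Δx))
  else if j = 2 then
    Δx ^ (-ν) * (Dtil0 ν * y 0 + Dtil1 ν * y Δx + Dtil2 ν * y (2 * Δx))
  else if j % 2 = 1 then
    Δx ^ (-ν) * ((∑ k ∈ Finset.range j, Dco ν (j / 2) k * y ((k : ℝ) * Δx))
      + alpha0 ν * y ((j : ℝ) * Δx))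
  else
    Δx ^ (-ν) * ((∑ k ∈ Finset.range j, Dbar ν (j / 2 - 1) k * y ((k : ℝ) * Δx))
      + alpha0 ν * y ((j : ℝ) * Δx))

/-- Truncation error r_j(Δx). -/
def trunc (ν Δx : ℝ) (y : ℝ → ℝ) (j : ℕ) : ℝ :=
  caputo ν y ((j : ℝ) * Δx) - discCaputo ν Δx y j

/-- The Mittag–Leffler function E_ν(z) = Σ_{k≥0} z^k/Γ(1+kν). -/
def mlE (ν z : ℝ) : ℝ := ∑' k : ℕ, z ^ k / Real.Gamma (1 + (k : ℝ) * ν)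

end

/-- The normalised contribution of a time segment lying at distances between `a` and `b` from the
evaluation point to the Caputo derivative of a quadratic whose first derivative at the oldest
point is `p` and whose second derivative is `s`. -/
noncomputable def segQuad (ν a b p s : ℝ) : ℝ :=
  1 / Real.Gamma (3 - ν) *
    ((2 - ν) * (b ^ (1 - ν) * p - a ^ (1 - ν) * (p + s * (b - a)))
      + s * (b ^ (2 - ν) - a ^ (2 - ν)))

/-- Initial slope of the quadratic interpolating `z` at `k, k + 1, k + 2`. -/
noncomputable def slope0 (z : ℕ → ℝ) (k : ℕ) : ℝ := (-3 * z k + 4 * z (k + 1) - z (k + 2)) / 2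

/-- Second derivative of the quadratic interpolating `z` at `k, k + 1, k + 2`. -/
noncomputable def curv (z : ℕ → ℝ) (k : ℕ) : ℝ := z k - 2 * z (k + 1) + z (k + 2)

/-- Coefficient of the newest node in the segment at distances `a` to `a + 2`. -/
noncomputable def segLast (ν a : ℝ) : ℝ :=
  1 / Real.Gamma (3 - ν) *
    (-((2 - ν) / 2) * ((a + 2) ^ (1 - ν) + 3 * a ^ (1 - ν)) + (a + 2) ^ (2 - ν) - a ^ (2 - ν))

lemma segLast_zero {ν : ℝ} (h0 : 0 < ν) (h1 : ν < 1) : segLast ν 0 = alpha0 ν := by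
  have hG : 0 < Real.Gamma (3 - ν) := Real.Gamma_pos_of_pos (by linarith)
  have e1 : (2 : ℝ) ^ (1 - ν) = 2 * ((2 : ℝ) ^ ν)⁻¹ := by
    rw [Real.rpow_sub two_pos, Real.rpow_one]; ring
  have e2 : (2 : ℝ) ^ (2 - ν) = 4 * ((2 : ℝ) ^ ν)⁻¹ := by
    rw [Real.rpow_sub two_pos]; norm_num; ring
  have h2 : (0 : ℝ) < 2 ^ ν := by positivity
  unfold segLast alpha0
  rw [Real.zero_rpow (by linarith), Real.zero_rpow (by linarith), zero_add, e1, e2]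
  field_simp
  ring

lemma Dbar_even (ν : ℝ) (m q : ℕ) : Dbar ν m (2 * (q + 1)) =
    (1 / Real.Gamma (3 - ν)) *
      (-((2 - ν) / 2) * ((2 * m - 2 * (q + 1) : ℝ) ^ (1 - ν)
          + 6 * (2 * m - 2 * q : ℝ) ^ (1 - ν)
          + (2 * m - 2 * q + 2 : ℝ) ^ (1 - ν))
        - (2 * m - 2 * (q + 1) : ℝ) ^ (2 - ν)
        + (2 * m - 2 * q + 2 : ℝ) ^ (2 - ν)) := by
  have h1 : 2 * (q + 1) % 2 = 0 := by omega
  have h2 : 2 * (q + 1) / 2 = q + 1 := by omega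
  have h3 : 2 * (q + 1) ≠ 0 := by omega
  simp only [Dbar, h1, h2, h3, if_true, if_false]
  push_cast
  have e1 : (2 * m - 2 * (q + 1) + 2 : ℝ) = 2 * m - 2 * q := by ring
  have e2 : (2 * m - 2 * (q + 1) + 4 : ℝ) = 2 * m - 2 * q + 2 := by ring
  rw [e1, e2]

lemma Dbar_odd (ν : ℝ) (m q : ℕ) : Dbar ν m (2 * q + 1) =
    (2 / Real.Gamma (3 - ν)) *
      ((2 - ν) * ((2 * m - 2 * q : ℝ) ^ (1 - ν) + (2 * m - 2 * q + 2 : ℝ) ^ (1 - ν))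
        + (2 * m - 2 * q : ℝ) ^ (2 - ν) - (2 * m - 2 * q + 2 : ℝ) ^ (2 - ν)) := by
  have h1 : (2 * q + 1) % 2 = 1 := by omega
  have h2 : (2 * q + 1) / 2 = q := by omega
  have h3 : 2 * q + 1 ≠ 0 := by omega
  simp only [Dbar, h1, h2, h3, if_false, one_ne_zero]

lemma sum_Dbar_partial (ν : ℝ) (m : ℕ) (z : ℕ → ℝ) (M : ℕ) :
    ∑ k ∈ range (2 * M + 2), Dbar ν m k * z k =
      (∑ q ∈ range (M + 1), segQuad ν (2 * m - 2 * q) (2 * m - 2 * q + 2)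
        (slope0 z (2 * q)) (curv z (2 * q))) - segLast ν (2 * m - 2 * M) * z (2 * M + 2) := by
  induction M with
  | zero =>
    have h1 := Dbar_odd ν m 0
    simp only [mul_zero, zero_add, Nat.cast_zero, sub_zero] at h1
    simp only [mul_zero, zero_add, Nat.cast_zero, sub_zero, sum_range_succ, sum_range_zero, h1,
      segQuad, slope0, curv, segLast]
    simp only [Dbar, if_true]
    ring
  | succ M ih =>
    rw [show 2 * (M + 1) + 2 = 2 * M + 2 + 1 + 1 by ring, sum_range_succ, sum_range_succ, ih,
      sum_range_succ _ (M + 1)]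
    have h1 := Dbar_odd ν m (M + 1)
    have h2 := Dbar_even ν m M
    rw [show 2 * (M + 1) + 1 = 2 * M + 2 + 1 by ring] at h1
    rw [show 2 * (M + 1) = 2 * M + 2 by ring] at h2
    rw [h1, h2]
    simp only [segQuad, slope0, curv, segLast, show 2 * (M + 1) = 2 * M + 2 by ring]
    push_cast
    have e1 : (2 * m - 2 * (M + 1) + 2 : ℝ) = 2 * m - 2 * M := by ring
    rw [e1]
    ring

lemma sum_Dbar_eq {ν : ℝ} (h0 : 0 < ν) (h1 : ν < 1) (m : ℕ) (z : ℕ → ℝ) :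
    (∑ k ∈ range (2 * m + 2), Dbar ν m k * z k) + alpha0 ν * z (2 * m + 2) =
      ∑ q ∈ range (m + 1), segQuad ν (2 * m - 2 * q) (2 * m - 2 * q + 2)
        (slope0 z (2 * q)) (curv z (2 * q)) := by
  rw [sum_Dbar_partial, sub_self, segLast_zero h0 h1]
  ring

lemma Dco_eq_Dbar (ν : ℝ) (m : ℕ) {k : ℕ} (hk : 3 ≤ k) : Dco ν m k = Dbar ν m (k + 1) := by
  simp only [Dco, show k ≠ 0 by omega, show k ≠ 1 by omega, show k ≠ 2 by omega, if_false]

lemma sum_Dco_partial (ν : ℝ) (m : ℕ) (z : ℕ → ℝ) (M : ℕ) :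
    ∑ k ∈ range (2 * M + 3), Dco ν m k * z k =
      segQuad ν (2 * m) (2 * m + 1) (slope0 z 0) (curv z 0) +
      (∑ q ∈ range (M + 1), segQuad ν (2 * m - 2 - 2 * q) (2 * m - 2 * q)
        (slope0 z (2 * q + 1)) (curv z (2 * q + 1)))
        - segLast ν (2 * m - 2 - 2 * M) * z (2 * M + 3) := by
  induction M with
  | zero =>
    simp only [mul_zero, zero_add, Nat.cast_zero, sub_zero, sum_range_succ, sum_range_zero,
      segQuad, slope0, curv, segLast]
    simp only [Dco, if_true, one_ne_zero, if_false, show (2:ℕ) ≠ 0 by norm_num,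
      show (2:ℕ) ≠ 1 by norm_num]
    have e1 : (2 * m - 2 + 2 : ℝ) = 2 * m := by ring
    rw [e1]
    ring
  | succ M ih =>
    rw [show 2 * (M + 1) + 3 = 2 * M + 3 + 1 + 1 by ring, sum_range_succ, sum_range_succ, ih,
      sum_range_succ _ (M + 1), Dco_eq_Dbar ν m (by omega), Dco_eq_Dbar ν m (by omega)]
    have h1 := Dbar_odd ν m (M + 1 + 1)
    have h2 := Dbar_even ν m (M + 1)
    rw [show 2 * (M + 1 + 1) + 1 = 2 * M + 3 + 1 + 1 by ring] at h1
    rw [show 2 * (M + 1 + 1) = 2 * M + 3 + 1 by ring] at h2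
    rw [h1, h2]
    simp only [segQuad, slope0, curv, segLast, show 2 * (M + 1) + 1 = 2 * M + 3 by ring]
    push_cast
    have e1 : (2 * m - 2 - 2 * (M + 1) + 2 : ℝ) = 2 * m - 2 - 2 * M := by ring
    have e2 : (2 * m - 2 * (M + 1) : ℝ) = 2 * m - 2 - 2 * M := by ring
    have e3 : (2 * m - 2 * (M + 1 + 1) : ℝ) = 2 * m - 2 - 2 * (M + 1) := by ring
    have e4 : (2 * m - 2 - 2 * M + 2 : ℝ) = 2 * m - 2 * M := by ring
    rw [e1, e3, e2, e4]
    ring_nf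

lemma sum_Dco_eq {ν : ℝ} (h0 : 0 < ν) (h1 : ν < 1) {m : ℕ} (hm : 1 ≤ m) (z : ℕ → ℝ) :
    (∑ k ∈ range (2 * m + 1), Dco ν m k * z k) + alpha0 ν * z (2 * m + 1) =
      segQuad ν (2 * m) (2 * m + 1) (slope0 z 0) (curv z 0) +
      ∑ q ∈ range m, segQuad ν (2 * m - 2 - 2 * q) (2 * m - 2 * q)
        (slope0 z (2 * q + 1)) (curv z (2 * q + 1)) := by
  obtain ⟨M, rfl⟩ : ∃ M, m = M + 1 := ⟨m - 1, by omega⟩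
  rw [show 2 * (M + 1) + 1 = 2 * M + 3 by ring, sum_Dco_partial]
  have e : (2 * ((M + 1 : ℕ) : ℝ) - 2 - 2 * M) = 0 := by push_cast; ring
  rw [e, segLast_zero h0 h1]
  ring

lemma initial_one {ν : ℝ} (h0 : 0 < ν) (h1 : ν < 1) (z : ℕ → ℝ) :
    Dhat0 ν * z 0 + Dhat1 ν * z 1 + Dhat2 ν * z 2 = segQuad ν 0 1 (slope0 z 0) (curv z 0) := by
  unfold segQuad slope0 curv Dhat0 Dhat1 Dhat2
  rw [Real.zero_rpow (by linarith), Real.zero_rpow (by linarith), Real.one_rpow, Real.one_rpow]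
  have hG : 0 < Real.Gamma (3 - ν) := Real.Gamma_pos_of_pos (by linarith)
  field_simp
  ring

lemma initial_two {ν : ℝ} (h0 : 0 < ν) (h1 : ν < 1) (z : ℕ → ℝ) :
    Dtil0 ν * z 0 + Dtil1 ν * z 1 + Dtil2 ν * z 2 = segQuad ν 0 2 (slope0 z 0) (curv z 0) := by
  have e1 : (2 : ℝ) ^ (1 - ν) = 2 * ((2 : ℝ) ^ ν)⁻¹ := by
    rw [Real.rpow_sub two_pos, Real.rpow_one]; ring
  have e2 : (2 : ℝ) ^ (2 - ν) = 4 * ((2 : ℝ) ^ ν)⁻¹ := by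
    rw [Real.rpow_sub two_pos]; norm_num; ring
  have h2 : (0 : ℝ) < 2 ^ ν := by positivity
  have hG : 0 < Real.Gamma (3 - ν) := Real.Gamma_pos_of_pos (by linarith)
  unfold segQuad slope0 curv Dtil0 Dtil1 Dtil2
  rw [Real.zero_rpow (by linarith), Real.zero_rpow (by linarith), e1, e2]
  field_simp
  ring

lemma rpow_one_sub' {ν a : ℝ} (ha : 0 < a) : a ^ (1 - ν) = a * a ^ (-ν) := by
  rw [sub_eq_add_neg, Real.rpow_add ha, Real.rpow_one]

lemma rpow_two_sub' {ν a : ℝ} (ha : 0 < a) : a ^ (2 - ν) = a ^ 2 * a ^ (-ν) := by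
  rw [sub_eq_add_neg, Real.rpow_add ha, Real.rpow_two]

lemma continuousOn_rpow_pos {a b : ℝ} (ha : 0 < a) (r : ℝ) :
    ContinuousOn (fun u : ℝ => u ^ r) (Set.Icc a b) :=
  fun u hu => (Real.continuousAt_rpow_const u r
    (Or.inl (lt_of_lt_of_le ha hu.1).ne')).continuousWithinAt

lemma integral_rpow_mul_quad {ν a b : ℝ} (h0 : 0 < ν) (h1 : ν < 1) (ha : 0 < a) (hab : a ≤ b)
    (p0 p1 p2 : ℝ) :
    ∫ u in a..b, u ^ (-1 - ν) * (p0 + p1 * u + p2 * u ^ 2) =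
      p0 * (a ^ (-ν) - b ^ (-ν)) / ν + p1 * (b * b ^ (-ν) - a * a ^ (-ν)) / (1 - ν)
        + p2 * (b ^ 2 * b ^ (-ν) - a ^ 2 * a ^ (-ν)) / (2 - ν) := by
  have hd : ∀ u ∈ Set.uIcc a b, HasDerivAt
      (fun u : ℝ => p0 * (-(u ^ (-ν)) / ν) + p1 * (u ^ (1 - ν) / (1 - ν))
        + p2 * (u ^ (2 - ν) / (2 - ν)))
      (u ^ (-1 - ν) * (p0 + p1 * u + p2 * u ^ 2)) u := by
    intro u hu
    rw [Set.uIcc_of_le hab] at hu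
    have hu0 : 0 < u := lt_of_lt_of_le ha hu.1
    have d0 := (Real.hasDerivAt_rpow_const (p := -ν) (Or.inl hu0.ne')).neg.div_const ν
    have d1 := (Real.hasDerivAt_rpow_const (p := 1 - ν) (Or.inl hu0.ne')).div_const (1 - ν)
    have d2 := (Real.hasDerivAt_rpow_const (p := 2 - ν) (Or.inl hu0.ne')).div_const (2 - ν)
    refine (((d0.const_mul p0).add (d1.const_mul p1)).add (d2.const_mul p2)).congr_deriv ?_
    have e0 : u ^ (-ν - 1) = u ^ (-1 - ν) := by congr 1; ring
    have e1 : u ^ (1 - ν - 1) = u * u ^ (-1 - ν) := by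
      rw [← Real.rpow_one_add' hu0.le (by linarith)]; congr 1; ring
    have e2 : u ^ (2 - ν - 1) = u ^ 2 * u ^ (-1 - ν) := by
      rw [← Real.rpow_two, ← Real.rpow_add hu0]; congr 1; ring
    rw [e0, e1, e2]
    have : 1 - ν ≠ 0 := by linarith
    have : 2 - ν ≠ 0 := by linarith
    field_simp
  have hb : 0 < b := lt_of_lt_of_le ha hab
  rw [intervalIntegral.integral_eq_sub_of_hasDerivAt hd]
  · simp only [rpow_one_sub' ha, rpow_one_sub' hb, rpow_two_sub' ha, rpow_two_sub' hb]
    ring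
  · apply ContinuousOn.intervalIntegrable
    rw [Set.uIcc_of_le hab]
    exact (continuousOn_rpow_pos ha _).mul (by fun_prop)

/-- Lower bound for the weighted integral of a quadratic by the integral of a continuous
minorant of the integrand. -/
lemma integral_le_integral_rpow_mul_quad {ν a b : ℝ} (ha : 0 < a) (hab : a ≤ b)
    (p0 p1 p2 : ℝ) {q : ℝ → ℝ} (hq : Continuous q)
    (h : ∀ u ∈ Set.Icc a b, q u ≤ u ^ (-1 - ν) * (p0 + p1 * u + p2 * u ^ 2)) :
    ∫ u in a..b, q u ≤ ∫ u in a..b, u ^ (-1 - ν) * (p0 + p1 * u + p2 * u ^ 2) := by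
  apply intervalIntegral.integral_mono_on hab (hq.intervalIntegrable _ _) _ h
  apply ContinuousOn.intervalIntegrable
  rw [Set.uIcc_of_le hab]
  exact (continuousOn_rpow_pos ha _).mul (by fun_prop)

lemma integral_quad (a b p0 p1 p2 : ℝ) :
    ∫ u in a..b, (p0 + p1 * u + p2 * u ^ 2) =
      p0 * (b - a) + p1 * ((b ^ 2 - a ^ 2) / 2) + p2 * ((b ^ 3 - a ^ 3) / 3) := by
  have hd : ∀ u ∈ Set.uIcc a b, HasDerivAt
      (fun u : ℝ => p0 * u + p1 * (u ^ 2 / 2) + p2 * (u ^ 3 / 3)) (p0 + p1 * u + p2 * u ^ 2) u := by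
    intro u _
    have hs := hasDerivAt_id' u
    refine (((hs.const_mul p0).add (((hs.pow 2).div_const 2).const_mul p1)).add
      (((hs.pow 3).div_const 3).const_mul p2)).congr_deriv ?_
    norm_num
  rw [intervalIntegral.integral_eq_sub_of_hasDerivAt hd
    (Continuous.intervalIntegrable (by fun_prop) _ _)]
  ring

/-- Lower bound for the weighted integral of a quadratic that is nonnegative left of `c` and
nonpositive right of it. -/
lemma integral_ge_of_sign_change {ν a b c I : ℝ} (h0 : 0 < ν) (ha : 0 < a) (hab : a ≤ b)
    (hc : 0 < c) (p0 p1 p2 : ℝ)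
    (hl : ∀ u ∈ Set.Icc a b, u ≤ c → 0 ≤ p0 + p1 * u + p2 * u ^ 2)
    (hr : ∀ u ∈ Set.Icc a b, c ≤ u → p0 + p1 * u + p2 * u ^ 2 ≤ 0)
    (hI : p0 * (b - a) + p1 * ((b ^ 2 - a ^ 2) / 2) + p2 * ((b ^ 3 - a ^ 3) / 3) = I) :
    c ^ (-1 - ν) * I ≤ ∫ u in a..b, u ^ (-1 - ν) * (p0 + p1 * u + p2 * u ^ 2) := by
  refine le_trans (le_of_eq ?_) (integral_le_integral_rpow_mul_quad (ν := ν) ha hab _ _ _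
    (q := fun u => c ^ (-1 - ν) * (p0 + p1 * u + p2 * u ^ 2)) (by fun_prop) ?_)
  · rw [intervalIntegral.integral_const_mul, integral_quad, hI]
  · intro u hu
    have hu0 : 0 < u := lt_of_lt_of_le ha hu.1
    rcases le_total u c with h | h
    · exact mul_le_mul_of_nonneg_right (Real.rpow_le_rpow_of_nonpos hu0 h (by linarith)) (hl u hu h)
    · exact mul_le_mul_of_nonpos_right (Real.rpow_le_rpow_of_nonpos hc h (by linarith)) (hr u hu h)

lemma bump_bound {ν a : ℝ} (h0 : 0 < ν) (ha : 0 < a) :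
    (a + 2) ^ (-1 - ν) * (4 / 3) ≤
      ∫ u in a..(a + 2), u ^ (-1 - ν) * (-(a * (a + 2)) + (2 * a + 2) * u + (-1) * u ^ 2) := by
  refine integral_ge_of_sign_change h0 ha (by linarith) (by linarith) _ _ _ ?_ ?_ (by ring)
  · intro u hu _
    nlinarith [mul_nonneg (sub_nonneg.2 hu.1) (sub_nonneg.2 hu.2)]
  · intro u hu h
    obtain rfl : u = a + 2 := le_antisymm hu.2 h
    linarith

lemma right_half_nonneg {ν a : ℝ} (h0 : 0 < ν) (h1 : ν < 1) (ha : 2 ≤ a) :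
    0 ≤ ∫ u in a..(a + 2), u ^ (-1 - ν) *
      (a * (a + 1) / 2 + (-(2 * a + 1) / 2) * u + 1 / 2 * u ^ 2) := by
  have ha0 : 0 < a := by linarith
  refine le_trans ?_ (integral_le_integral_rpow_mul_quad (ν := ν) ha0 (by linarith) _ _ _
    (q := fun u => (a + 1) ^ (-1 - ν) * ((1 - (u - (a + 1)) / 2) ^ 2 *
      (a * (a + 1) / 2 + (-(2 * a + 1) / 2) * u + 1 / 2 * u ^ 2))) (by fun_prop) ?_)
  · rw [intervalIntegral.integral_const_mul]
    apply mul_nonneg (by positivity)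
    have hd : ∀ u ∈ Set.uIcc a (a + 2), HasDerivAt
        (fun u : ℝ => ((u - (a + 1)) ^ 5 / 40 - 3 * (u - (a + 1)) ^ 4 / 32 + (u - (a + 1)) ^ 2 / 4))
        ((1 - (u - (a + 1)) / 2) ^ 2 *
          (a * (a + 1) / 2 + (-(2 * a + 1) / 2) * u + 1 / 2 * u ^ 2)) u := by
      intro u _
      have hs := (hasDerivAt_id' u).sub_const (a + 1)
      refine ((((hs.pow 5).div_const 40).sub (((hs.pow 4).const_mul 3).div_const 32)).add ((hs.pow 2).div_const 4)).congr_deriv ?_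
      simp
      ring
    rw [intervalIntegral.integral_eq_sub_of_hasDerivAt hd
      (Continuous.intervalIntegrable (by fun_prop) _ _)]
    ring_nf
    norm_num
  · intro u hu
    have hu0 : 0 < u := lt_of_lt_of_le ha0 hu.1
    set t := u - (a + 1) with ht
    have htl : -1 ≤ t := by linarith [hu.1]
    have htu : t ≤ 1 := by linarith [hu.2]
    have hP : a * (a + 1) / 2 + (-(2 * a + 1) / 2) * u + 1 / 2 * u ^ 2 = t * (t + 1) / 2 := by
      rw [ht]; ring
    rw [hP]
    have hw : u ^ (-1 - ν) = (a + 1) ^ (-1 - ν) * (u / (a + 1)) ^ (-1 - ν) := by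
      rw [← Real.mul_rpow (by linarith) (by positivity)]; congr 1; field_simp
    rw [hw, mul_assoc]
    apply mul_le_mul_of_nonneg_left _ (by positivity)
    set r := u / (a + 1) with hr
    have hr0 : 0 < r := by positivity
    have hr1 : r = 1 + t / (a + 1) := by rw [hr, ht]; field_simp; ring
    have h3 : 0 < 1 + t / 3 := by linarith
    have hinv : (1 + t / 3) ^ (-2 : ℝ) = ((1 + t / 3) ^ 2)⁻¹ := by
      rw [Real.rpow_neg h3.le, Real.rpow_two]
    rcases le_total t 0 with hneg | hpos
    · have hkey : r ^ (-1 - ν) ≤ (1 - t / 2) ^ 2 := by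
        have s1 : 1 + t / 3 ≤ r := by
          rw [hr1]
          have : t / 3 ≤ t / (a + 1) := by
            rw [div_le_div_iff₀ (by norm_num) (by linarith)]; nlinarith
          linarith
        have hr_le : r ≤ 1 := by
          rw [hr1]; have : t / (a + 1) ≤ 0 := div_nonpos_of_nonpos_of_nonneg hneg (by linarith)
          linarith
        calc r ^ (-1 - ν) ≤ r ^ (-2 : ℝ) :=
              Real.rpow_le_rpow_of_exponent_ge hr0 hr_le (by linarith)
          _ ≤ (1 + t / 3) ^ (-2 : ℝ) := Real.rpow_le_rpow_of_nonpos h3 s1 (by norm_num)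
          _ ≤ (1 - t / 2) ^ 2 := by
              rw [hinv, inv_le_iff_one_le_mul₀ (by positivity), ← mul_pow]
              apply one_le_pow₀
              nlinarith
      have : t * (t + 1) / 2 ≤ 0 := by nlinarith
      exact mul_le_mul_of_nonpos_right hkey this
    · have hkey : (1 - t / 2) ^ 2 ≤ r ^ (-1 - ν) := by
        have s1 : r ≤ 1 + t / 3 := by
          rw [hr1]
          have : t / (a + 1) ≤ t / 3 := by
            rw [div_le_div_iff₀ (by linarith) (by norm_num)]; nlinarith
          linarith
        have hr_ge : 1 ≤ r := by
          rw [hr1]; have : 0 ≤ t / (a + 1) := by positivity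
          linarith
        calc (1 - t / 2) ^ 2 ≤ (1 + t / 3) ^ (-2 : ℝ) := by
              rw [hinv, le_inv_comm₀ (by nlinarith) (by positivity), ← inv_pow]
              have : 0 < 1 - t / 2 := by linarith
              refine pow_le_pow_left₀ h3.le ?_ 2
              rw [le_inv_comm₀ h3 this, le_inv_comm₀ this h3, le_inv_comm₀ h3 this,
                ← one_div, le_div_iff₀ h3]
              nlinarith
          _ ≤ r ^ (-2 : ℝ) := Real.rpow_le_rpow_of_nonpos hr0 s1 (by norm_num)
          _ ≤ r ^ (-1 - ν) := Real.rpow_le_rpow_of_exponent_le hr_ge (by linarith)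
      exact mul_le_mul_of_nonneg_right hkey (by positivity)

section powers
variable {ν a : ℝ}

lemma cubic_weight_pos (h0 : 0 < ν) (h1 : ν < 1) : 0 < ν * (1 - ν) * (2 - ν) :=
  mul_pos (mul_pos h0 (by linarith)) (by linarith)

lemma midpoint_weight_ge (h0 : 0 < ν) (h1 : ν < 1) (ha : 0 < a) :
    ν * (1 - ν) * (2 - ν) * ((a + 2) ^ (-1 - ν) * (4 / 3)) ≤
      2 * ((a + 2) ^ (2 - ν) - a ^ (2 - ν)
        - (2 - ν) * (a ^ (1 - ν) + (a + 2) ^ (1 - ν))) := by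
  have h := bump_bound h0 ha
  have hσ := cubic_weight_pos h0 h1
  refine (mul_le_mul_of_nonneg_left h hσ.le).trans (le_of_eq ?_)
  have hb : 0 < a + 2 := by linarith
  have : 1 - ν ≠ 0 := by linarith
  have : 2 - ν ≠ 0 := by linarith
  rw [integral_rpow_mul_quad h0 h1 ha (by linarith), rpow_one_sub' ha, rpow_one_sub' hb,
    rpow_two_sub' ha, rpow_two_sub' hb]
  field_simp
  ring

lemma oldest_weight_ge (h0 : 0 < ν) (h1 : ν < 1) (ha : 2 ≤ a) :
    (1 - ν) * (2 - ν) * (a + 2) ^ (-ν) ≤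
      (2 - ν) / 2 * (a ^ (1 - ν) + 3 * (a + 2) ^ (1 - ν)) + a ^ (2 - ν) - (a + 2) ^ (2 - ν) := by
  have h := right_half_nonneg h0 h1 ha
  have hσ := cubic_weight_pos h0 h1
  have h' := mul_nonneg hσ.le h
  have ha0 : 0 < a := by linarith
  have hb : 0 < a + 2 := by linarith
  have : 1 - ν ≠ 0 := by linarith
  have : 2 - ν ≠ 0 := by linarith
  rw [integral_rpow_mul_quad h0 h1 ha0 (by linarith)] at h'
  rw [← sub_nonneg, rpow_one_sub' ha0, rpow_one_sub' hb, rpow_two_sub' ha0, rpow_two_sub' hb]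
  refine h'.trans (le_of_eq ?_)
  field_simp
  ring

lemma newest_weight_ge (h0 : 0 < ν) (h1 : ν < 1) (ha : 0 < a) :
    -((1 - ν) * (2 - ν) * a ^ (-ν)) ≤
      (2 - ν) / 2 * ((a + 2) ^ (1 - ν) + 3 * a ^ (1 - ν)) - (a + 2) ^ (2 - ν) + a ^ (2 - ν) := by
  have h := integral_ge_of_sign_change (ν := ν) (a := a) (b := a + 2) (c := a + 1) (I := 1 / 3)
    h0 ha (by linarith) (by linarith) ((a + 1) * (a + 2) / 2) (-(2 * a + 3) / 2) (1 / 2)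
    (fun u hu h => by nlinarith [mul_nonneg (sub_nonneg.2 h) (sub_nonneg.2 hu.2)])
    (fun u hu h => by nlinarith [mul_nonneg (sub_nonneg.2 h) (sub_nonneg.2 hu.2)])
    (by ring)
  have hσ := cubic_weight_pos h0 h1
  have hb : 0 < a + 2 := by linarith
  have h' := mul_nonneg hσ.le (le_trans (by positivity) h)
  have : 1 - ν ≠ 0 := by linarith
  have : 2 - ν ≠ 0 := by linarith
  rw [integral_rpow_mul_quad h0 h1 ha (by linarith)] at h'
  rw [← sub_nonneg, rpow_one_sub' ha, rpow_one_sub' hb, rpow_two_sub' ha, rpow_two_sub' hb]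
  refine h'.trans (le_of_eq ?_)
  field_simp
  ring

lemma boundary_weight_nonneg (h0 : 0 < ν) (h1 : ν < 1) (ha : 2 ≤ a) :
    0 ≤ (2 - ν) / 2 * (a ^ (1 - ν) + 6 * (a + 2) ^ (1 - ν) + (a + 4) ^ (1 - ν))
        + a ^ (2 - ν) - (a + 4) ^ (2 - ν) := by
  have e1 := oldest_weight_ge h0 h1 ha
  have e2 := newest_weight_ge h0 h1 (show 0 < a + 2 by linarith)
  rw [show a + 2 + 2 = a + 4 by ring] at e2
  linarith

lemma startup_zero_weight_ge (h0 : 0 < ν) (h1 : ν < 1) (ha : 0 < a) :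
    (1 - ν) * (2 - ν) * (a + 1) ^ (-ν) ≤
      -((2 - ν) / 2 * (a ^ (1 - ν) - 3 * (a + 1) ^ (1 - ν))) + a ^ (2 - ν)
        - (a + 1) ^ (2 - ν) := by
  have h : 0 ≤ ∫ u in a..(a + 1), u ^ (-1 - ν) *
      (a * (a - 1) / 2 + (-(2 * a - 1) / 2) * u + 1 / 2 * u ^ 2) :=
    intervalIntegral.integral_nonneg (by linarith) fun u hu =>
      mul_nonneg (Real.rpow_nonneg (by linarith [hu.1]) _)
        (by nlinarith [mul_nonneg (sub_nonneg.2 hu.1) (sub_nonneg.2 hu.1), hu.1])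
  have hσ := cubic_weight_pos h0 h1
  have hb : 0 < a + 1 := by linarith
  have h' := mul_nonneg hσ.le h
  have : 1 - ν ≠ 0 := by linarith
  have : 2 - ν ≠ 0 := by linarith
  rw [integral_rpow_mul_quad h0 h1 ha (by linarith)] at h'
  rw [← sub_nonneg, rpow_one_sub' ha, rpow_one_sub' hb, rpow_two_sub' ha, rpow_two_sub' hb]
  refine h'.trans (le_of_eq ?_)
  field_simp
  ring

lemma startup_one_weight_nonneg (h0 : 0 < ν) (h1 : ν < 1) (ha : 2 ≤ a) :
    0 ≤ (2 - ν) / 2 * (a ^ (1 - ν) + 3 * (a + 2) ^ (1 - ν) - 4 * (a + 3) ^ (1 - ν))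
        + a ^ (2 - ν) - 3 * (a + 2) ^ (2 - ν) + 2 * (a + 3) ^ (2 - ν) := by
  have e1 := oldest_weight_ge h0 h1 ha
  have hA : 0 < a + 2 := by linarith
  have hB : 0 < a + 3 := by linarith
  have h := integral_ge_of_sign_change (ν := ν) (a := a + 2) (b := a + 3) (c := a + 3)
    (I := 2 / 3) h0 hA (by linarith) (by linarith)
    (-((a + 3) * (a + 1))) (2 * a + 4) (-1)
    (fun u hu h => by
      nlinarith [mul_nonneg (sub_nonneg.2 hu.2) (show 0 ≤ u - (a + 1) by linarith [hu.1])])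
    (fun u hu h => by obtain rfl : u = a + 3 := le_antisymm hu.2 h
                      linarith)
    (by ring)
  have hσ := cubic_weight_pos h0 h1
  have h' := mul_nonneg hσ.le (le_trans (by positivity) h)
  have : 1 - ν ≠ 0 := by linarith
  have : 2 - ν ≠ 0 := by linarith
  rw [integral_rpow_mul_quad h0 h1 hA (by linarith)] at h'
  have h2 : 0 ≤ -(1 - ν) * (2 - ν) * (-(a + 2) ^ (-ν)) +
    (-(2 * (2 - ν) * (a + 3) ^ (1 - ν)) - 2 * (a + 2) ^ (2 - ν) + 2 * (a + 3) ^ (2 - ν)) := by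
    rw [rpow_one_sub' hB, rpow_two_sub' hA, rpow_two_sub' hB]
    refine h'.trans (le_of_eq ?_)
    field_simp
    ring
  linarith

lemma startup_two_weight_ge (h0 : 0 < ν) (h1 : ν < 1) (ha : 0 < a) :
    ν * (1 - ν) * (2 - ν) * ((a + 2) ^ (-1 - ν) * (5 / 4)) ≤
      -((2 - ν) / 2 * (4 * a ^ (1 - ν) + 3 * (a + 2) ^ (1 - ν) - (a + 3) ^ (1 - ν)))
        - 2 * a ^ (2 - ν) + 3 * (a + 2) ^ (2 - ν) - (a + 3) ^ (2 - ν) := by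
  have e1 := midpoint_weight_ge h0 h1 ha
  have hA : 0 < a + 2 := by linarith
  have hB : 0 < a + 3 := by linarith
  have h := integral_ge_of_sign_change (ν := ν) (a := a + 2) (b := a + 3) (c := a + 2)
    (I := -1 / 12) h0 hA (by linarith) (by linarith)
    ((a + 3) * (a + 2) / 2) (-(2 * a + 5) / 2) (1 / 2)
    (fun u hu h => by obtain rfl : u = a + 2 := le_antisymm h hu.1
                      linarith)
    (fun u hu h => by nlinarith [mul_nonneg (sub_nonneg.2 hu.2) (sub_nonneg.2 hu.1)])
    (by ring)
  have hσ := cubic_weight_pos h0 h1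
  have h' := mul_le_mul_of_nonneg_left h hσ.le
  have : 1 - ν ≠ 0 := by linarith
  have : 2 - ν ≠ 0 := by linarith
  rw [integral_rpow_mul_quad h0 h1 hA (by linarith)] at h'
  have h2 : ν * (1 - ν) * (2 - ν) * ((a + 2) ^ (-1 - ν) * (-1 / 12)) ≤
      (2 - ν) / 2 * ((a + 2) ^ (1 - ν) + (a + 3) ^ (1 - ν)) + (a + 2) ^ (2 - ν)
        - (a + 3) ^ (2 - ν) := by
    rw [rpow_one_sub' hA, rpow_one_sub' hB, rpow_two_sub' hA, rpow_two_sub' hB]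
    refine h'.trans (le_of_eq ?_)
    field_simp
    ring
  linarith

end powers

section coefficients
variable {ν : ℝ}

lemma alpha0_pos (h0 : 0 < ν) (h1 : ν < 1) : 0 < alpha0 ν := by
  have hG : 0 < Real.Gamma (3 - ν) := Real.Gamma_pos_of_pos (by linarith)
  unfold alpha0
  positivity

lemma gamma_mul_alpha0 (h1 : ν < 1) : Real.Gamma (3 - ν) * alpha0 ν = (ν + 2) * 2 ^ (-ν) := by
  have hG : 0 < Real.Gamma (3 - ν) := Real.Gamma_pos_of_pos (by linarith)
  have h2 : (0 : ℝ) < 2 ^ ν := by positivity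
  rw [alpha0, Real.rpow_neg two_pos.le]
  field_simp

lemma dco_even_index (ν : ℝ) (m k : ℕ) : dco ν (2 * m + 2) k = -Dbar ν m k / alpha0 ν := by
  rw [dco, if_neg (by omega), show (2 * m + 2) / 2 - 1 = m by omega]

lemma dco_odd_index (ν : ℝ) (m k : ℕ) : dco ν (2 * m + 1) k = -Dco ν m k / alpha0 ν := by
  rw [dco, if_pos (by omega), show (2 * m + 1) / 2 = m by omega]

/-- Away from the start-up nodes the coefficients are those of `Dbar` at a shifted index. -/
lemma dco_eq_Dbar (ν : ℝ) {n k : ℕ} (hn : 4 ≤ n) (hk : 3 ≤ k ∨ 1 ≤ k ∧ n % 2 = 0) :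
    ∃ m l : ℕ, dco ν n k = -Dbar ν m l / alpha0 ν ∧ 1 ≤ m ∧ 1 ≤ l ∧ l + n = 2 * m + 2 + k := by
  rcases Nat.even_or_odd' n with ⟨j, rfl | rfl⟩
  · obtain ⟨m, rfl⟩ : ∃ m, j = m + 1 := ⟨j - 1, by omega⟩
    exact ⟨m, k, dco_even_index ν m k, by omega, by omega, by omega⟩
  · have hk3 : 3 ≤ k := by omega
    exact ⟨j, k + 1, by rw [dco_odd_index, Dco_eq_Dbar ν j hk3], by omega, by omega, by omega⟩

lemma le_div_alpha0 (h0 : 0 < ν) (h1 : ν < 1) {x D w : ℝ} (hD : D = -(1 / Real.Gamma (3 - ν)) * w)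
    (h : x ≤ w) : x / (Real.Gamma (3 - ν) * alpha0 ν) ≤ -D / alpha0 ν := by
  have hG : 0 < Real.Gamma (3 - ν) := Real.Gamma_pos_of_pos (by linarith)
  have := alpha0_pos h0 h1
  rw [hD, show -(-(1 / Real.Gamma (3 - ν)) * w) / alpha0 ν = w / (Real.Gamma (3 - ν) * alpha0 ν) by
    field_simp]
  gcongr

lemma dco_zero_ge (h0 : 0 < ν) (h1 : ν < 1) {n : ℕ} (hn : 4 ≤ n) :
    (1 - ν) * (2 - ν) * (n : ℝ) ^ (-ν) / (Real.Gamma (3 - ν) * alpha0 ν) ≤ dco ν n 0 := by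
  rcases Nat.even_or_odd' n with ⟨j, rfl | rfl⟩
  · obtain ⟨m, rfl⟩ : ∃ m, j = m + 1 := ⟨j - 1, by omega⟩
    have hm : (2 : ℝ) ≤ 2 * m := by
      have : (1 : ℝ) ≤ m := by exact_mod_cast (by omega : 1 ≤ m)
      linarith
    rw [show 2 * (m + 1) = 2 * m + 2 by ring, dco_even_index]
    push_cast
    refine le_div_alpha0 h0 h1 ?_ (oldest_weight_ge h0 h1 hm)
    simp only [Dbar, if_true]
    ring
  · have hm : (0 : ℝ) < 2 * j := by
      have : (2 : ℝ) ≤ j := by exact_mod_cast (by omega : 2 ≤ j)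
      linarith
    rw [dco_odd_index]
    push_cast
    refine le_div_alpha0 h0 h1 ?_ (startup_zero_weight_ge h0 h1 hm)
    simp only [Dco, if_true]
    ring

lemma Dbar_midpoint_ge (h0 : 0 < ν) (h1 : ν < 1) {m q : ℕ} (h : q + 1 ≤ m) :
    ν * (1 - ν) * (2 - ν) * ((2 * m - 2 * q + 2 : ℝ) ^ (-1 - ν) * (5 / 4)) /
      (Real.Gamma (3 - ν) * alpha0 ν) ≤ -Dbar ν m (2 * q + 1) / alpha0 ν := by
  have ha : (0 : ℝ) < 2 * m - 2 * q := by
    have : (q : ℝ) + 1 ≤ m := by exact_mod_cast h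
    linarith
  refine le_div_alpha0 h0 h1 (w := _) ?_ (le_trans ?_ (midpoint_weight_ge h0 h1 ha))
  · rw [Dbar_odd]
    ring
  · have := cubic_weight_pos h0 h1
    exact mul_le_mul_of_nonneg_left (mul_le_mul_of_nonneg_left (by norm_num)
      (Real.rpow_nonneg (by linarith) _)) this.le

lemma Dbar_boundary_nonneg (h0 : 0 < ν) (h1 : ν < 1) {m q : ℕ} (h : q + 2 ≤ m) :
    0 ≤ -Dbar ν m (2 * (q + 1)) / alpha0 ν := by
  have ha : (2 : ℝ) ≤ 2 * m - 2 * (q + 1) := by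
    have : (q : ℝ) + 2 ≤ m := by exact_mod_cast h
    linarith
  refine le_trans (le_of_eq (zero_div _).symm)
    (le_div_alpha0 h0 h1 ?_ (boundary_weight_nonneg h0 h1 ha))
  rw [Dbar_even, show (2 * m - 2 * (q + 1) + 2 : ℝ) = 2 * m - 2 * q by ring,
    show (2 * m - 2 * (q + 1) + 4 : ℝ) = 2 * m - 2 * q + 2 by ring]
  ring

lemma dco_odd_distance_ge (h0 : 0 < ν) (h1 : ν < 1) {n k : ℕ} (hk : 1 ≤ k)
    (hkn : k + 3 ≤ n) (hodd : (n - k) % 2 = 1) :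
    ν * (1 - ν) * (2 - ν) * ((n - k + 1 : ℝ) ^ (-1 - ν) * (5 / 4)) /
      (Real.Gamma (3 - ν) * alpha0 ν) ≤ dco ν n k := by
  by_cases hc : 3 ≤ k ∨ 1 ≤ k ∧ n % 2 = 0
  · obtain ⟨m, l, e, hm, hl, hs⟩ := dco_eq_Dbar ν (by omega : 4 ≤ n) hc
    obtain ⟨q, rfl⟩ : ∃ q, l = 2 * q + 1 := ⟨l / 2, by omega⟩
    have hs' : (2 * q + 1 + n : ℝ) = 2 * m + 2 + k := by exact_mod_cast hs
    rw [e, show (n - k + 1 : ℝ) = 2 * m - 2 * q + 2 by linarith]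
    exact Dbar_midpoint_ge h0 h1 (by omega)
  · obtain rfl : k = 2 := by omega
    obtain ⟨m, rfl⟩ : ∃ m, n = 2 * m + 1 := ⟨n / 2, by omega⟩
    have ha : (0 : ℝ) < 2 * m - 2 := by
      have : (2 : ℝ) ≤ m := by exact_mod_cast (by omega : 2 ≤ m)
      linarith
    rw [dco_odd_index]
    refine le_div_alpha0 h0 h1 ?_ (le_trans (le_of_eq ?_) (startup_two_weight_ge h0 h1 ha))
    · simp only [Dco, show (2:ℕ) ≠ 0 by norm_num, show (2:ℕ) ≠ 1 by norm_num, if_false, if_true]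
      rw [show (2 * m - 2 + 2 : ℝ) = 2 * m by ring, show (2 * m - 2 + 3 : ℝ) = 2 * m + 1 by ring]
      ring
    · push_cast
      rw [show (2 * m + 1 - 2 + 1 : ℝ) = 2 * m - 2 + 2 by ring]

lemma dco_nonneg (h0 : 0 < ν) (h1 : ν < 1) {n k : ℕ} (hn : 4 ≤ n) (hkn : k + 3 ≤ n) :
    0 ≤ dco ν n k := by
  have hG : 0 < Real.Gamma (3 - ν) := Real.Gamma_pos_of_pos (by linarith)
  have hα := alpha0_pos h0 h1
  have hσ := cubic_weight_pos h0 h1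
  have hν1 : 0 < 1 - ν := by linarith
  have hν2 : 0 < 2 - ν := by linarith
  rcases Nat.eq_zero_or_pos k with rfl | hk
  · exact le_trans (by positivity) (dco_zero_ge h0 h1 hn)
  · by_cases hodd : (n - k) % 2 = 1
    · refine le_trans ?_ (dco_odd_distance_ge h0 h1 hk hkn hodd)
      have : (0 : ℝ) ≤ n - k + 1 := by
        have : (k : ℝ) + 3 ≤ n := by exact_mod_cast hkn
        linarith
      positivity
    · by_cases hc : 3 ≤ k ∨ 1 ≤ k ∧ n % 2 = 0
      · obtain ⟨m, l, e, hm, hl, hs⟩ := dco_eq_Dbar ν hn hc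
        obtain ⟨q, rfl⟩ : ∃ q, l = 2 * (q + 1) := ⟨l / 2 - 1, by omega⟩
        rw [e]
        exact Dbar_boundary_nonneg h0 h1 (by omega)
      · obtain rfl : k = 1 := by omega
        obtain ⟨m, rfl⟩ : ∃ m, n = 2 * m + 1 := ⟨n / 2, by omega⟩
        have ha : (2 : ℝ) ≤ 2 * m - 2 := by
          have : (2 : ℝ) ≤ m := by exact_mod_cast (by omega : 2 ≤ m)
          linarith
        rw [dco_odd_index]
        refine le_trans (le_of_eq (zero_div _).symm)
          (le_div_alpha0 h0 h1 ?_ (startup_one_weight_nonneg h0 h1 ha))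
        simp only [Dco, one_ne_zero, if_false, if_true]
        rw [show (2 * m - 2 + 2 : ℝ) = 2 * m by ring, show (2 * m - 2 + 3 : ℝ) = 2 * m + 1 by ring]
        ring

lemma dco_distance_one (h0 : 0 < ν) (h1 : ν < 1) {n : ℕ} (hn : 4 ≤ n) :
    dco ν n (n - 1) = 2 * theta ν := by
  obtain ⟨m, l, e, hm, hl, hs⟩ := dco_eq_Dbar ν hn (k := n - 1) (by omega)
  obtain rfl : l = 2 * m + 1 := by omega
  have hG : 0 < Real.Gamma (3 - ν) := Real.Gamma_pos_of_pos (by linarith)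
  have h2 : (0 : ℝ) < 2 ^ (-ν) := by positivity
  rw [e, Dbar_odd, sub_self, zero_add, Real.zero_rpow (by linarith), Real.zero_rpow (by linarith),
    rpow_one_sub' two_pos, rpow_two_sub' two_pos, theta, eq_div_of_mul_eq hG.ne'
      ((mul_comm _ _).trans (gamma_mul_alpha0 h1))]
  field_simp
  ring

lemma two_rpow_neg_le (h0 : 0 < ν) (h1 : ν < 1) :
    (2 : ℝ) ^ (-ν) ≤ 1 - 2 / 3 * ν + 9 / 50 * ν ^ 2 := by
  rw [Real.rpow_neg two_pos.le, inv_le_iff_one_le_mul₀ (by positivity),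
    Real.rpow_def_of_pos two_pos]
  have hl : 0.6931 ≤ Real.log 2 := by linarith [Real.log_two_gt_d9]
  have hx : 0.6931 * ν ≤ Real.log 2 * ν := by gcongr
  have he : 1 + 0.6931 * ν + (0.6931 * ν) ^ 2 / 2 + (0.6931 * ν) ^ 3 / 6 ≤
      Real.exp (Real.log 2 * ν) := by
    refine le_trans ?_ (Real.exp_le_exp.2 hx)
    refine le_trans (le_of_eq ?_) (Real.sum_le_exp_of_nonneg (by positivity) 4)
    simp [Finset.sum_range_succ, Nat.factorial]
  have hq : 0 < 1 - 2 / 3 * ν + 9 / 50 * ν ^ 2 := by nlinarith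
  refine le_trans ?_ (mul_le_mul_of_nonneg_left he hq.le)
  nlinarith [mul_nonneg h0.le (sub_nonneg.2 h1.le), pow_pos h0 2, pow_pos h0 3, pow_pos h0 4,
    mul_nonneg (pow_pos h0 2).le (sub_nonneg.2 h1.le),
    mul_nonneg (pow_pos h0 3).le (sub_nonneg.2 h1.le), pow_pos h0 5,
    mul_nonneg h0.le (sq_nonneg (ν - 1)), mul_nonneg h0.le (sq_nonneg (ν - 1/2))]

lemma dco_distance_two (h0 : 0 < ν) (h1 : ν < 1) {n : ℕ} (hn : 4 ≤ n) :
    0 ≤ theta ν ^ 2 + dco ν n (n - 2) := by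
  obtain ⟨m, l, e, hm, hl, hs⟩ := dco_eq_Dbar ν hn (k := n - 2) (by omega)
  obtain ⟨q, rfl⟩ : ∃ q, m = q + 1 := ⟨m - 1, by omega⟩
  obtain rfl : l = 2 * (q + 1) := by omega
  have hG : 0 < Real.Gamma (3 - ν) := Real.Gamma_pos_of_pos (by linarith)
  have h2 : (0 : ℝ) < 2 ^ (-ν) := by positivity
  have h4 : (4 : ℝ) ^ (-ν) = 2 ^ (-ν) * 2 ^ (-ν) := by
    rw [← Real.mul_rpow two_pos.le two_pos.le]; norm_num
  have key := two_rpow_neg_le h0 h1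
  have hD : dco ν n (n - 2) =
      -(2 * (-6 + 3 * ν + (6 + ν) * 2 ^ (-ν))) / (2 + ν) := by
    rw [e, Dbar_even]
    push_cast
    rw [sub_self, show (2 * ((q : ℝ) + 1) - 2 * q) = 2 by ring, show (2 : ℝ) + 2 = 4 by norm_num,
      Real.zero_rpow (by linarith), Real.zero_rpow (by linarith),
      rpow_one_sub' two_pos, rpow_one_sub' four_pos, rpow_two_sub' four_pos, h4,
      eq_div_of_mul_eq hG.ne' ((mul_comm _ _).trans (gamma_mul_alpha0 h1))]
    field_simp
    ring
  rw [hD, theta, div_pow, show -(2 * (-6 + 3 * ν + (6 + ν) * (2 : ℝ) ^ (-ν))) / (2 + ν) =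
    -(2 * (-6 + 3 * ν + (6 + ν) * 2 ^ (-ν))) * (2 + ν) / (2 + ν) ^ 2 by field_simp, ← add_div]
  apply div_nonneg _ (by positivity)
  have hk : (6 + ν) * (2 : ℝ) ^ (-ν) ≤ (6 + ν) * (1 - 2 / 3 * ν + 9 / 50 * ν ^ 2) := by gcongr
  have hk2 := mul_le_mul_of_nonneg_right hk (show 0 ≤ 2 * (2 + ν) by linarith)
  nlinarith [pow_pos h0 2, pow_pos h0 3, mul_nonneg (pow_pos h0 2).le (sub_nonneg.2 h1.le),
    mul_nonneg (pow_pos h0 3).le (sub_nonneg.2 h1.le)]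

lemma segQuad_zero (ν a b : ℝ) : segQuad ν a b 0 0 = 0 := by simp [segQuad]

lemma sum_dco_eq_one (h0 : 0 < ν) (h1 : ν < 1) {n : ℕ} (hn : 4 ≤ n) :
    ∑ k ∈ range n, dco ν n k = 1 := by
  have hα := alpha0_pos h0 h1
  have hs : ∀ k, slope0 (fun _ => 1) k = 0 := fun k => by norm_num [slope0]
  have hc : ∀ k, curv (fun _ => 1) k = 0 := fun k => by norm_num [curv]
  rcases Nat.even_or_odd' n with ⟨j, rfl | rfl⟩
  · obtain ⟨m, rfl⟩ : ∃ m, j = m + 1 := ⟨j - 1, by omega⟩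
    have h := sum_Dbar_eq h0 h1 m (fun _ => 1)
    simp only [hs, hc, segQuad_zero, sum_const_zero, mul_one] at h
    rw [show 2 * (m + 1) = 2 * m + 2 by ring]
    simp only [dco_even_index]
    rw [← sum_div, sum_neg_distrib, div_eq_one_iff_eq hα.ne']
    linarith
  · have h := sum_Dco_eq h0 h1 (by omega : 1 ≤ j) (fun _ => 1)
    simp only [hs, hc, segQuad_zero, sum_const_zero, mul_one] at h
    simp only [dco_odd_index]
    rw [← sum_div, sum_neg_distrib, div_eq_one_iff_eq hα.ne']
    linarith

end coefficients

lemma rpow_neg_step {ν u : ℝ} (h0 : 0 < ν) (h1 : ν < 1) (hu : 4 ≤ u) :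
    (u - 2) ^ (-ν) ≤ u ^ (-ν) + 4 * u ^ (-1 - ν) := by
  have hu0 : 0 < u := by linarith
  have hr0 : 0 < 1 - 2 / u := by rw [sub_pos, div_lt_one hu0]; linarith
  have hr1 : 1 - 2 / u ≤ 1 := by linarith [show 0 < 2 / u by positivity]
  have e1 : (u - 2) ^ (-ν) = u ^ (-ν) * (1 - 2 / u) ^ (-ν) := by
    rw [← Real.mul_rpow hu0.le hr0.le]; congr 1; field_simp
  have e2 : u ^ (-1 - ν) = u ^ (-ν) * u⁻¹ := by
    rw [sub_eq_add_neg, add_comm, Real.rpow_add hu0, Real.rpow_neg_one]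
  have e3 : (1 - 2 / u) ^ (-ν) ≤ (1 - 2 / u)⁻¹ := by
    rw [← Real.rpow_neg_one (1 - 2 / u)]
    exact Real.rpow_le_rpow_of_exponent_ge hr0 hr1 (by linarith)
  have e4 : (1 - 2 / u)⁻¹ ≤ 1 + 4 * u⁻¹ := by
    rw [inv_le_iff_one_le_mul₀ hr0]
    have hv : u * u⁻¹ = 1 := mul_inv_cancel₀ hu0.ne'
    have hv0 : 0 < u⁻¹ := by positivity
    have hv4 : 4 * u⁻¹ ≤ 1 := by nlinarith
    rw [div_eq_mul_inv]
    nlinarith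
  rw [e1, e2]
  have := mul_le_mul_of_nonneg_left (e3.trans e4) (Real.rpow_nonneg hu0.le (-ν))
  linarith

/-- The coefficients have tails of the same size as those of the continuous fractional kernel. -/
lemma exists_dco_tail_ge {ν : ℝ} (h0 : 0 < ν) (h1 : ν < 1) :
    ∃ c > 0, ∀ n i : ℕ, 4 ≤ n → 3 ≤ i →
      c * (i : ℝ) ^ (-ν) ≤ ∑ k ∈ range (n - i + 1), dco ν n k := by
  have hGα : 0 < Real.Gamma (3 - ν) * alpha0 ν :=
    mul_pos (Real.Gamma_pos_of_pos (by linarith)) (alpha0_pos h0 h1)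
  have hσ := cubic_weight_pos h0 h1
  set c0 := (1 - ν) * (2 - ν) / (Real.Gamma (3 - ν) * alpha0 ν) with hc0
  set c1 := ν * (1 - ν) * (2 - ν) * (5 / 4) / (Real.Gamma (3 - ν) * alpha0 ν) with hc1
  have hc0p : 0 < c0 := div_pos (mul_pos (by linarith) (by linarith)) hGα
  have hc1p : 0 < c1 := by positivity
  set c := min (c0 / 2) (c1 / 4) with hc
  have hcp : 0 < c := lt_min (by linarith) (by linarith)
  have hcc0 : c ≤ c0 / 2 := min_le_left _ _
  have hcc1 : c ≤ c1 / 4 := min_le_right _ _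
  have hzero : ∀ n : ℕ, 4 ≤ n → c0 * (n : ℝ) ^ (-ν) ≤ dco ν n 0 := fun n hn => by
    refine le_trans (le_of_eq ?_) (dco_zero_ge h0 h1 hn)
    rw [hc0]; ring
  have key : ∀ n : ℕ, 4 ≤ n → ∀ j : ℕ, j + 3 ≤ n →
      c * ((n : ℝ) - j) ^ (-ν) ≤ ∑ k ∈ range (j + 1), dco ν n k := by
    intro n hn j
    induction j using Nat.twoStepInduction with
    | zero =>
      intro _
      have hp : 0 ≤ (n : ℝ) ^ (-ν) := by positivity
      simp only [Nat.cast_zero, sub_zero, zero_add, sum_range_one]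
      nlinarith [hzero n hn]
    | one =>
      intro h3
      have hn' : (4 : ℝ) ≤ n := by exact_mod_cast hn
      have hd := dco_nonneg h0 h1 hn h3
      have hp : 0 ≤ ((n : ℝ) - 1) ^ (-ν) := Real.rpow_nonneg (by linarith) _
      have e : 1 / 2 * ((n : ℝ) - 1) ^ (-ν) ≤ (n : ℝ) ^ (-ν) := by
        have e1 : (2 * ((n : ℝ) - 1)) ^ (-ν) ≤ (n : ℝ) ^ (-ν) :=
          Real.rpow_le_rpow_of_nonpos (by linarith) (by linarith) (by linarith)
        rw [Real.mul_rpow two_pos.le (by linarith)] at e1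
        have e2 : (2 : ℝ) ^ (-1 : ℝ) ≤ 2 ^ (-ν) :=
          Real.rpow_le_rpow_of_exponent_le one_le_two (by linarith)
        rw [Real.rpow_neg_one] at e2
        nlinarith
      rw [sum_range_succ, sum_range_one, Nat.cast_one]
      nlinarith [hzero n hn]
    | more j ih _ =>
      intro h3
      have ih' := ih (by omega)
      have hd1 := dco_nonneg h0 h1 hn (show j + 1 + 3 ≤ n by omega)
      have hd2 := dco_nonneg h0 h1 hn (show j + 2 + 3 ≤ n by omega)
      rw [sum_range_succ, sum_range_succ]
      have hu : (j : ℝ) + 2 + 3 ≤ n := by exact_mod_cast h3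
      have hstep := rpow_neg_step h0 h1 (show 4 ≤ (n : ℝ) - j by linarith)
      have hgain : c1 * ((n : ℝ) - j) ^ (-1 - ν) ≤ dco ν n (j + 1) + dco ν n (j + 2) := by
        by_cases hodd : (n - (j + 1)) % 2 = 1
        · have := dco_odd_distance_ge h0 h1 (show 1 ≤ j + 1 by omega)
            (show j + 1 + 3 ≤ n by omega) hodd
          push_cast at this
          rw [show (n : ℝ) - (j + 1) + 1 = n - j by ring] at this
          have e : c1 * ((n : ℝ) - j) ^ (-1 - ν) = ν * (1 - ν) * (2 - ν) *
            (((n : ℝ) - j) ^ (-1 - ν) * (5 / 4)) / (Real.Gamma (3 - ν) * alpha0 ν) := by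
            rw [hc1]; ring
          linarith
        · have := dco_odd_distance_ge h0 h1 (show 1 ≤ j + 2 by omega)
            (show j + 2 + 3 ≤ n by omega) (by omega)
          push_cast at this
          have hmono : ((n : ℝ) - j) ^ (-1 - ν) ≤ (n - (j + 2) + 1) ^ (-1 - ν) :=
            Real.rpow_le_rpow_of_nonpos (by linarith) (by linarith) (by linarith)
          have e : c1 * ((n : ℝ) - (j + 2) + 1) ^ (-1 - ν) = ν * (1 - ν) * (2 - ν) *
            (((n : ℝ) - (j + 2) + 1) ^ (-1 - ν) * (5 / 4)) / (Real.Gamma (3 - ν) * alpha0 ν) := by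
            rw [hc1]; ring
          nlinarith
      have hp : 0 ≤ ((n : ℝ) - j) ^ (-1 - ν) := Real.rpow_nonneg (by linarith) _
      push_cast
      rw [show (n : ℝ) - (j + 2) = n - j - 2 by ring]
      nlinarith
  refine ⟨c, hcp, fun n i hn hi => ?_⟩
  rcases le_total n i with h | h
  · rw [Nat.sub_eq_zero_of_le h]
    refine le_trans ?_ (key n hn 0 (by omega))
    rw [Nat.cast_zero, sub_zero]
    have hn0 : (0 : ℝ) < n := by exact_mod_cast (by omega : 0 < n)
    exact mul_le_mul_of_nonneg_left (Real.rpow_le_rpow_of_nonpos hn0 (by exact_mod_cast h)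
      (by linarith)) hcp.le
  · have := key n hn (n - i) (by omega)
    rwa [Nat.cast_sub h, sub_sub_cancel] at this

section stability
variable {ν : ℝ}

lemma gamma_three_sub_le (h0 : 0 < ν) (h1 : ν < 1) : Real.Gamma (3 - ν) ≤ 2 := by
  have h := Real.convexOn_Gamma.2 (show (2 : ℝ) ∈ Set.Ioi 0 by norm_num)
    (show (3 : ℝ) ∈ Set.Ioi 0 by norm_num) h0.le (sub_nonneg.2 h1.le) (by ring)
  have g3 : Real.Gamma 3 = 2 := by
    rw [show (3 : ℝ) = 2 + 1 by norm_num, Real.Gamma_add_one two_ne_zero, Real.Gamma_two, mul_one]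
  simp only [smul_eq_mul, Real.Gamma_two, g3] at h
  rw [show ν * 2 + (1 - ν) * 3 = 3 - ν by ring] at h
  linarith

lemma two_rpow_le (h1 : ν < 1) : (2 : ℝ) ^ ν ≤ 2 := by
  simpa using Real.rpow_le_rpow_of_exponent_le one_le_two h1.le

lemma half_le_alpha0 (h0 : 0 < ν) (h1 : ν < 1) : 1 / 2 ≤ alpha0 ν := by
  have hG : 0 < Real.Gamma (3 - ν) := Real.Gamma_pos_of_pos (by linarith)
  have h2 : (0 : ℝ) < 2 ^ ν := by positivity
  have := mul_le_mul (two_rpow_le h1) (gamma_three_sub_le h0 h1) hG.le zero_le_two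
  rw [alpha0, div_le_div_iff₀ two_pos (by positivity)]
  linarith

lemma theta_nonneg (h0 : 0 < ν) : 0 ≤ theta ν := by unfold theta; positivity

lemma theta_le (h0 : 0 < ν) (h1 : ν < 1) : theta ν ≤ 2 / 3 := by
  rw [theta, div_le_div_iff₀ (by linarith) (by norm_num)]; linarith

lemma row_rewrite (h0 : 0 < ν) (h1 : ν < 1) {p : ℕ} (hp : 2 ≤ p) (e : ℕ → ℝ) :
    (∑ k ∈ range (p + 2), dco ν (p + 2) k * e k) - theta ν * e (p + 1) =
      theta ν * (e (p + 1) - theta ν * e p) + (theta ν ^ 2 + dco ν (p + 2) p) * e p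
        + ∑ k ∈ range p, dco ν (p + 2) k * e k := by
  have := dco_distance_one h0 h1 (show 4 ≤ p + 2 by omega)
  rw [show p + 2 - 1 = p + 1 by omega] at this
  rw [sum_range_succ, sum_range_succ, this]
  ring

lemma row_sum (h0 : 0 < ν) (h1 : ν < 1) {p : ℕ} (hp : 2 ≤ p) :
    (theta ν ^ 2 + dco ν (p + 2) p) + ∑ k ∈ range p, dco ν (p + 2) k = (1 - theta ν) ^ 2 := by
  have := dco_distance_one h0 h1 (show 4 ≤ p + 2 by omega)
  have hs := sum_dco_eq_one h0 h1 (show 4 ≤ p + 2 by omega)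
  rw [show p + 2 - 1 = p + 1 by omega] at this
  rw [sum_range_succ, sum_range_succ, this] at hs
  linarith

/-- If the filtered values grow at most like `A * E ^ k`, so does the history part of a row. -/
lemma row_bound_growth (h0 : 0 < ν) (h1 : ν < 1) {p : ℕ} (hp : 2 ≤ p) {e : ℕ → ℝ} {A B E : ℝ}
    (hE : 1 ≤ E) (hB : 0 ≤ B) (hAB : A = B * (1 - theta ν))
    (hf : |e (p + 1) - theta ν * e p| ≤ A * E ^ (p + 1))
    (he : ∀ k ≤ p, |e k| ≤ B * E ^ k) :
    |(∑ k ∈ range (p + 2), dco ν (p + 2) k * e k) - theta ν * e (p + 1)| ≤ A * E ^ (p + 1) := by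
  rw [row_rewrite h0 h1 hp]
  have hδ := dco_distance_two h0 h1 (show 4 ≤ p + 2 by omega)
  rw [show p + 2 - 2 = p by omega] at hδ
  have ht := theta_nonneg h0
  have hs := row_sum h0 h1 hp
  have hbound : ∀ k ≤ p, |e k| ≤ B * E ^ (p + 1) := fun k hk =>
    (he k hk).trans (mul_le_mul_of_nonneg_left (pow_le_pow_right₀ hE (by omega)) hB)
  have hsum : |∑ k ∈ range p, dco ν (p + 2) k * e k| ≤
      (∑ k ∈ range p, dco ν (p + 2) k) * (B * E ^ (p + 1)) := by
    rw [sum_mul]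
    refine (abs_sum_le_sum_abs _ _).trans (sum_le_sum fun k hk => ?_)
    have hk' := mem_range.1 hk
    have hd := dco_nonneg h0 h1 (show 4 ≤ p + 2 by omega) (show k + 3 ≤ p + 2 by omega)
    rw [abs_mul, abs_of_nonneg hd]
    exact mul_le_mul_of_nonneg_left (hbound k hk'.le) hd
  calc _ ≤ |theta ν * (e (p + 1) - theta ν * e p)| + |(theta ν ^ 2 + dco ν (p + 2) p) * e p|
        + |∑ k ∈ range p, dco ν (p + 2) k * e k| := abs_add_three _ _ _
    _ ≤ theta ν * (A * E ^ (p + 1)) + (theta ν ^ 2 + dco ν (p + 2) p) * (B * E ^ (p + 1))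
        + (∑ k ∈ range p, dco ν (p + 2) k) * (B * E ^ (p + 1)) := by
        rw [abs_mul, abs_mul, abs_of_nonneg ht, abs_of_nonneg hδ]
        gcongr
        exact hbound p le_rfl
    _ = theta ν * (A * E ^ (p + 1)) + (1 - theta ν) ^ 2 * (B * E ^ (p + 1)) := by rw [← hs]; ring
    _ = A * E ^ (p + 1) := by rw [hAB]; ring

lemma row_bound_tail (h0 : 0 < ν) (h1 : ν < 1) {p i : ℕ} (hp : 2 ≤ p) (hi : 3 ≤ i)
    {e : ℕ → ℝ} {A B E : ℝ}
    (hE : 1 ≤ E) (hB : 0 ≤ B) (hAB : A = B * (1 - theta ν)) (hez : e 0 = 0)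
    (hf : |e (p + 1) - theta ν * e p| ≤ A * E ^ (p + 1))
    (he : ∀ k ≤ p, |e k| ≤ B * E ^ k) :
    |(∑ k ∈ range (p + 2), dco ν (p + 2) k * e k) - theta ν * e (p + 1)| ≤
      A * E ^ (p + 2) * (1 - (1 - (E ^ i)⁻¹) * ∑ k ∈ range (p + 2 - i + 1), dco ν (p + 2) k) := by
  rw [row_rewrite h0 h1 hp]
  have hδ := dco_distance_two h0 h1 (show 4 ≤ p + 2 by omega)
  rw [show p + 2 - 2 = p by omega] at hδ
  have ht := theta_nonneg h0
  have ht1 : 0 ≤ 1 - theta ν := by linarith [theta_le h0 h1]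
  have hs := row_sum h0 h1 hp
  have hE0 : 0 < E := by linarith
  have hEi : (E ^ i)⁻¹ ≤ 1 := inv_le_one_of_one_le₀ (one_le_pow₀ hE)
  have hdn : ∀ k < p, 0 ≤ dco ν (p + 2) k := fun k hk =>
    dco_nonneg h0 h1 (show 4 ≤ p + 2 by omega) (show k + 3 ≤ p + 2 by omega)
  have hsub : range (p + 2 - i + 1) ⊆ range p := range_subset_range.2 (by omega)
  have htail : 0 ≤ ∑ k ∈ range (p + 2 - i + 1), dco ν (p + 2) k :=
    sum_nonneg fun k hk => hdn k (mem_range.1 (hsub hk))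
  have hbound : ∀ k ≤ p, |e k| ≤ B * E ^ (p + 2) := fun k hk =>
    (he k hk).trans (mul_le_mul_of_nonneg_left (pow_le_pow_right₀ hE (by omega)) hB)
  have hbound' : ∀ k < p + 2 - i + 1, |e k| ≤ B * E ^ (p + 2) * (E ^ i)⁻¹ := by
    intro k hk
    rcases Nat.eq_zero_or_pos k with rfl | hk0
    · rw [hez, abs_zero]; positivity
    · refine (he k (by omega)).trans ?_
      rw [mul_assoc]
      refine mul_le_mul_of_nonneg_left ?_ hB
      rw [← div_eq_mul_inv, le_div_iff₀ (by positivity), ← pow_add]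
      exact pow_le_pow_right₀ hE (by omega)
  have hsum : |∑ k ∈ range p, dco ν (p + 2) k * e k| ≤
      (∑ k ∈ range p, dco ν (p + 2) k) * (B * E ^ (p + 2)) -
        (B * E ^ (p + 2)) * (1 - (E ^ i)⁻¹) * ∑ k ∈ range (p + 2 - i + 1), dco ν (p + 2) k := by
    refine (abs_sum_le_sum_abs _ _).trans ?_
    rw [← sum_sdiff hsub, ← sum_sdiff hsub]
    have b1 : ∑ k ∈ range p \ range (p + 2 - i + 1), |dco ν (p + 2) k * e k| ≤
        (∑ k ∈ range p \ range (p + 2 - i + 1), dco ν (p + 2) k) * (B * E ^ (p + 2)) := by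
      rw [sum_mul]
      refine sum_le_sum fun k hk => ?_
      have hk' := mem_range.1 (mem_sdiff.1 hk).1
      rw [abs_mul, abs_of_nonneg (hdn k hk')]
      exact mul_le_mul_of_nonneg_left (hbound k hk'.le) (hdn k hk')
    have b2 : ∑ k ∈ range (p + 2 - i + 1), |dco ν (p + 2) k * e k| ≤
        (∑ k ∈ range (p + 2 - i + 1), dco ν (p + 2) k) * (B * E ^ (p + 2) * (E ^ i)⁻¹) := by
      rw [sum_mul]
      refine sum_le_sum fun k hk => ?_
      have hk' := mem_range.1 (hsub hk)
      rw [abs_mul, abs_of_nonneg (hdn k hk')]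
      exact mul_le_mul_of_nonneg_left (hbound' k (mem_range.1 hk)) (hdn k hk')
    linarith
  have hgain : 0 ≤ (B - A) * (E ^ (p + 2) * (1 - (E ^ i)⁻¹) *
      ∑ k ∈ range (p + 2 - i + 1), dco ν (p + 2) k) := by
    have h1 : 0 ≤ 1 - (E ^ i)⁻¹ := by linarith
    have h2 : 0 ≤ B - A := by rw [hAB]; nlinarith
    positivity
  calc _ ≤ |theta ν * (e (p + 1) - theta ν * e p)| + |(theta ν ^ 2 + dco ν (p + 2) p) * e p|
        + |∑ k ∈ range p, dco ν (p + 2) k * e k| := abs_add_three _ _ _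
    _ ≤ theta ν * (A * E ^ (p + 2)) + (theta ν ^ 2 + dco ν (p + 2) p) * (B * E ^ (p + 2))
        + ((∑ k ∈ range p, dco ν (p + 2) k) * (B * E ^ (p + 2)) -
        (B * E ^ (p + 2)) * (1 - (E ^ i)⁻¹) *
          ∑ k ∈ range (p + 2 - i + 1), dco ν (p + 2) k) := by
        rw [abs_mul, abs_mul, abs_of_nonneg ht, abs_of_nonneg hδ]
        have hA : 0 ≤ A := hAB ▸ mul_nonneg hB ht1
        have hf' : |e (p + 1) - theta ν * e p| ≤ A * E ^ (p + 2) :=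
          hf.trans (mul_le_mul_of_nonneg_left (pow_le_pow_right₀ hE (by omega)) hA)
        gcongr
        exact hbound p le_rfl
    _ = theta ν * (A * E ^ (p + 2)) + (1 - theta ν) ^ 2 * (B * E ^ (p + 2)) -
        (B * E ^ (p + 2)) * (1 - (E ^ i)⁻¹) *
          ∑ k ∈ range (p + 2 - i + 1), dco ν (p + 2) k := by rw [← hs]; ring
    _ = A * E ^ (p + 2) - (B * E ^ (p + 2)) * (1 - (E ^ i)⁻¹) *
          ∑ k ∈ range (p + 2 - i + 1), dco ν (p + 2) k := by rw [hAB]; ring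
    _ ≤ _ := by linarith

/-- A growth rate for which every row gains the factor `1 - 7 * L * h ^ ν`, uniformly in the step. -/
lemma exists_growth_rate (h0 : 0 < ν) (h1 : ν < 1) {L : ℝ} (hL : 0 < L) :
    ∃ r > 0, ∀ h : ℝ, 0 < h → L * h ^ ν ≤ 1 / 216 → ∀ (p : ℕ) (e : ℕ → ℝ) (A B : ℝ), 2 ≤ p →
      0 ≤ B → A = B * (1 - theta ν) → e 0 = 0 →
      |e (p + 1) - theta ν * e p| ≤ A * Real.exp (r * h) ^ (p + 1) →
      (∀ k ≤ p, |e k| ≤ B * Real.exp (r * h) ^ k) →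
      |(∑ k ∈ range (p + 2), dco ν (p + 2) k * e k) - theta ν * e (p + 1)| ≤
        A * Real.exp (r * h) ^ (p + 2) * (1 - 7 * (L * h ^ ν)) := by
  obtain ⟨c, hc, htail⟩ := exists_dco_tail_ge h0 h1
  set r := (56 * L / c) ^ (1 / ν) with hr
  have hr0 : 0 < r := by positivity
  have hrν : r ^ ν = 56 * L / c := by
    rw [hr, ← Real.rpow_mul (by positivity), one_div_mul_cancel h0.ne', Real.rpow_one]
  refine ⟨r, hr0, fun h hh hκ p e A B hp hB hAB hez hf he => ?_⟩
  set E := Real.exp (r * h) with hEdef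
  have hE : 1 ≤ E := Real.one_le_exp (by positivity)
  have hE0 : 0 < E := by linarith
  have ht1 : 0 ≤ 1 - theta ν := by linarith [theta_le h0 h1]
  have hA : 0 ≤ A := hAB ▸ mul_nonneg hB ht1
  have hexp1 : (2 : ℝ) ≤ Real.exp 1 := by linarith [Real.add_one_le_exp 1]
  rcases le_total 1 (r * h) with hbig | hsmall
  · refine (row_bound_growth h0 h1 hp hE hB hAB hf he).trans ?_
    have hE2 : 2 ≤ E := hexp1.trans (Real.exp_le_exp.2 hbig)
    rw [pow_succ E (p + 1)]
    have : 1 ≤ E * (1 - 7 * (L * h ^ ν)) := by nlinarith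
    have hAE : 0 ≤ A * E ^ (p + 1) := by positivity
    nlinarith
  · set i := ⌈1 / (r * h)⌉₊ + 2 with hi
    have hrh : 0 < r * h := by positivity
    have hceil : 1 ≤ ⌈1 / (r * h)⌉₊ := Nat.ceil_pos.2 (by positivity)
    refine (row_bound_tail h0 h1 hp (show 3 ≤ i by omega) hE hB hAB hez hf he).trans ?_
    refine mul_le_mul_of_nonneg_left ?_ (by positivity)
    have hil : 1 / (r * h) ≤ i := by
      rw [hi]; push_cast; linarith [Nat.le_ceil (1 / (r * h))]
    have hiu : (i : ℝ) ≤ 4 / (r * h) := by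
      have h1' : (⌈1 / (r * h)⌉₊ : ℝ) < 1 / (r * h) + 1 := Nat.ceil_lt_add_one (by positivity)
      have h2' : 1 ≤ 1 / (r * h) := by rw [le_div_iff₀ hrh]; linarith
      have h3' : 4 / (r * h) = 4 * (1 / (r * h)) := by ring
      rw [hi, h3']; push_cast; linarith
    have hEi : (E ^ i)⁻¹ ≤ 1 / 2 := by
      rw [hEdef, ← Real.exp_nat_mul, inv_eq_one_div]
      refine one_div_le_one_div_of_le two_pos (hexp1.trans (Real.exp_le_exp.2 ?_))
      rwa [div_le_iff₀ hrh] at hil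
    have ht := htail (p + 2) i (by omega) (by omega)
    have hi0 : (0 : ℝ) < i := by exact_mod_cast (by omega : 0 < i)
    have hpow : 1 / 4 * (r ^ ν * h ^ ν) ≤ (i : ℝ) ^ (-ν) := by
      refine le_trans ?_ (Real.rpow_le_rpow_of_nonpos hi0 hiu (by linarith))
      rw [Real.div_rpow (by norm_num) hrh.le, Real.rpow_neg hrh.le, div_inv_eq_mul,
        Real.mul_rpow hr0.le hh.le]
      refine mul_le_mul_of_nonneg_right ?_ (by positivity)
      have : (4 : ℝ) ^ (-1 : ℝ) ≤ 4 ^ (-ν) :=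
        Real.rpow_le_rpow_of_exponent_le (by norm_num) (by linarith)
      rwa [Real.rpow_neg_one, inv_eq_one_div] at this
    rw [hrν] at hpow
    have hS : 14 * (L * h ^ ν) ≤ ∑ k ∈ range (p + 2 - i + 1), dco ν (p + 2) k := by
      refine le_trans ?_ ht
      have := mul_le_mul_of_nonneg_left hpow hc.le
      have e1 : c * (1 / 4 * (56 * L / c * h ^ ν)) = 14 * (L * h ^ ν) := by field_simp; ring
      linarith
    have hκ0 : 0 ≤ L * h ^ ν := by positivity
    nlinarith

end stability

section stability
variable {ν : ℝ}

lemma initial_bound (h0 : 0 < ν) (h1 : ν < 1) {κ η a b : ℝ} (hκ : κ ≤ 1 / 216)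
    (hb1 : |Dhat1 ν * a + Dhat2 ν * b| ≤ κ * |a| + η)
    (hb2 : |Dtil1 ν * a + Dtil2 ν * b| ≤ κ * |b| + η) : |a| + |b| ≤ 24 * η := by
  have hG : 0 < Real.Gamma (3 - ν) := Real.Gamma_pos_of_pos (by linarith)
  have hG2 := gamma_three_sub_le h0 h1
  have h2 : (0 : ℝ) < 2 ^ ν := by positivity
  have h22 := two_rpow_le h1
  have hX : |2 * (1 - ν) * a + ν / 2 * b| ≤ 2 * (κ * |a| + η) := by
    have : 2 * (1 - ν) * a + ν / 2 * b
        = Real.Gamma (3 - ν) * (Dhat1 ν * a + Dhat2 ν * b) := by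
      unfold Dhat1 Dhat2; field_simp
    rw [this, abs_mul, abs_of_pos hG]
    exact mul_le_mul hG2 hb1 (abs_nonneg _) zero_le_two
  have hY : |-(4 * ν) * a + (ν + 2) * b| ≤ 4 * (κ * |b| + η) := by
    have : -(4 * ν) * a + (ν + 2) * b
        = (2 ^ ν * Real.Gamma (3 - ν)) * (Dtil1 ν * a + Dtil2 ν * b) := by
      unfold Dtil1 Dtil2; field_simp
    rw [this, abs_mul, abs_of_pos (by positivity)]
    refine mul_le_mul ?_ hb2 (abs_nonneg _) (by norm_num)
    calc _ ≤ (2 : ℝ) * 2 := mul_le_mul h22 hG2 hG.le zero_le_two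
      _ = 4 := by norm_num
  set X := 2 * (1 - ν) * a + ν / 2 * b with hXd
  set Y := -(4 * ν) * a + (ν + 2) * b with hYd
  have ea : (4 - 2 * ν) * a = (ν + 2) * X - ν / 2 * Y := by rw [hXd, hYd]; ring
  have eb : (4 - 2 * ν) * b = 4 * ν * X + 2 * (1 - ν) * Y := by rw [hXd, hYd]; ring
  have ha : 2 * |a| ≤ 3 * |X| + |Y| / 2 := by
    have e1 : (4 - 2 * ν) * |a| ≤ (ν + 2) * |X| + ν / 2 * |Y| := by
      rw [← abs_of_pos (show 0 < 4 - 2 * ν by linarith), ← abs_mul, ea]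
      refine (abs_sub _ _).trans ?_
      rw [abs_mul, abs_mul, abs_of_pos (show 0 < ν + 2 by linarith),
        abs_of_pos (show 0 < ν / 2 by linarith)]
    nlinarith [abs_nonneg a, abs_nonneg X, abs_nonneg Y]
  have hb : 2 * |b| ≤ 4 * |X| + 2 * |Y| := by
    have e1 : (4 - 2 * ν) * |b| ≤ 4 * ν * |X| + 2 * (1 - ν) * |Y| := by
      rw [← abs_of_pos (show 0 < 4 - 2 * ν by linarith), ← abs_mul, eb]
      refine (abs_add_le _ _).trans ?_
      rw [abs_mul (4 * ν), abs_mul (2 * (1 - ν)), abs_of_pos (show 0 < 4 * ν by linarith),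
        abs_of_pos (show 0 < 2 * (1 - ν) by linarith)]
    nlinarith [abs_nonneg b, abs_nonneg X, abs_nonneg Y]
  have := mul_le_mul_of_nonneg_right hκ (abs_nonneg a)
  have := mul_le_mul_of_nonneg_right hκ (abs_nonneg b)
  linarith [abs_nonneg a, abs_nonneg b]

lemma third_bound (h0 : 0 < ν) (h1 : ν < 1) {κ η : ℝ} (hκ : κ ≤ 1 / 216) (hη : 0 ≤ η)
    {e : ℕ → ℝ} (he0 : e 0 = 0) (he1 : |e 1| ≤ 24 * η) (he2 : |e 2| ≤ 24 * η)
    (h3 : |(∑ k ∈ range 3, Dco ν 1 k * e k) + alpha0 ν * e 3| ≤ κ * |e 3| + η) :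
    |e 3| ≤ 3 * (24 * (|Dco ν 1 1| + |Dco ν 1 2|) + 1) * η := by
  have ha := half_le_alpha0 h0 h1
  have e1 : alpha0 ν * e 3 = ((∑ k ∈ range 3, Dco ν 1 k * e k) + alpha0 ν * e 3)
      - (Dco ν 1 1 * e 1 + Dco ν 1 2 * e 2) := by
    simp only [sum_range_succ, sum_range_zero, he0]; ring
  have e2 : alpha0 ν * |e 3| ≤ (κ * |e 3| + η)
      + (|Dco ν 1 1| * (24 * η) + |Dco ν 1 2| * (24 * η)) := by
    rw [← abs_of_pos (show 0 < alpha0 ν by linarith), ← abs_mul, e1]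
    refine (abs_sub _ _).trans (add_le_add h3 ((abs_add_le _ _).trans ?_))
    rw [abs_mul, abs_mul]
    gcongr
  have h4 := mul_le_mul_of_nonneg_right ha (abs_nonneg (e 3))
  have h5 := mul_le_mul_of_nonneg_right hκ (abs_nonneg (e 3))
  have h6 : 0 ≤ |Dco ν 1 1| * η + |Dco ν 1 2| * η := by positivity
  linarith

/-- Rows of index at least four, normalised so that the diagonal coefficient is one. -/
lemma normalised_row (h0 : 0 < ν) (h1 : ν < 1) {κ η : ℝ} {n M : ℕ} (hn : 4 ≤ n) (hM : n ≤ M)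
    {e : ℕ → ℝ}
    (hodd : ∀ m : ℕ, 1 ≤ m → 2 * m + 1 ≤ M →
      |(∑ k ∈ range (2 * m + 1), Dco ν m k * e k) + alpha0 ν * e (2 * m + 1)|
        ≤ κ * |e (2 * m + 1)| + η)
    (heven : ∀ m : ℕ, 1 ≤ m → 2 * m + 2 ≤ M →
      |(∑ k ∈ range (2 * m + 2), Dbar ν m k * e k) + alpha0 ν * e (2 * m + 2)|
        ≤ κ * |e (2 * m + 2)| + η) :
    |e n - ∑ k ∈ range n, dco ν n k * e k| ≤ 2 * (κ * |e n| + η) := by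
  have ha := half_le_alpha0 h0 h1
  have hpos : 0 < alpha0 ν := by linarith
  have main : ∀ D : ℕ → ℝ, (∀ k, dco ν n k = -D k / alpha0 ν) →
      |(∑ k ∈ range n, D k * e k) + alpha0 ν * e n| ≤ κ * |e n| + η →
      |e n - ∑ k ∈ range n, dco ν n k * e k| ≤ 2 * (κ * |e n| + η) := by
    intro D hD hb
    have h2 : (∑ k ∈ range n, D k * e k) + alpha0 ν * e n
        = alpha0 ν * (e n - ∑ k ∈ range n, dco ν n k * e k) := by
      have : ∀ k ∈ range n, D k * e k = -(alpha0 ν * (dco ν n k * e k)) := by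
        intro k _
        rw [hD k]; field_simp
      rw [sum_congr rfl this, sum_neg_distrib, ← mul_sum]
      ring
    rw [h2, abs_mul, abs_of_pos hpos] at hb
    have h3 := mul_le_mul_of_nonneg_right ha
      (abs_nonneg (e n - ∑ k ∈ range n, dco ν n k * e k))
    linarith
  rcases Nat.even_or_odd' n with ⟨q, rfl | rfl⟩
  · obtain ⟨m, rfl⟩ : ∃ m, q = m + 1 := ⟨q - 1, by omega⟩
    exact main (Dbar ν m) (dco_even_index ν m) (heven m (by omega) (by omega))
  · exact main (Dco ν q) (dco_odd_index ν q) (hodd q (by omega) hM)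

lemma absorb_diagonal {κ η A Z t v w W : ℝ} (hκ0 : 0 ≤ κ) (hκ : κ ≤ 1 / 216) (hZ : 1 ≤ Z)
    (hA : 0 ≤ A) (hη : 2 * η ≤ κ * A) (ht : t ≤ 2 * A) (hv : v ≤ t * Z) (hw : w ≤ W + v)
    (hW : W ≤ A * Z * (1 - 7 * κ) + 2 * (κ * w + η)) : W ≤ A * Z := by
  have htZ : t * Z ≤ 2 * A * Z := mul_le_mul_of_nonneg_right ht (by linarith)
  have hκA : κ * A ≤ κ * (A * Z) :=
    mul_le_mul_of_nonneg_left (le_mul_of_one_le_right hA hZ) hκ0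
  have hκw : κ * w ≤ κ * (W + 2 * A * Z) := mul_le_mul_of_nonneg_left (by linarith) hκ0
  have : (1 - 2 * κ) * W ≤ (1 - 2 * κ) * (A * Z) := by linarith
  exact le_of_mul_le_mul_left this (by linarith)

set_option maxHeartbeats 400000 in
theorem exists_stability_bound (h0 : 0 < ν) (h1 : ν < 1) {L T : ℝ} (hL : 0 < L) :
    ∃ C > 0, ∀ (M : ℕ) (h η : ℝ) (e : ℕ → ℝ), 0 < h → M * h ≤ T → L * h ^ ν ≤ 1 / 216 →
      0 ≤ η → e 0 = 0 →
      |Dhat1 ν * e 1 + Dhat2 ν * e 2| ≤ L * h ^ ν * |e 1| + η →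
      |Dtil1 ν * e 1 + Dtil2 ν * e 2| ≤ L * h ^ ν * |e 2| + η →
      (∀ m : ℕ, 1 ≤ m → 2 * m + 1 ≤ M →
        |(∑ k ∈ range (2 * m + 1), Dco ν m k * e k) + alpha0 ν * e (2 * m + 1)|
          ≤ L * h ^ ν * |e (2 * m + 1)| + η) →
      (∀ m : ℕ, 1 ≤ m → 2 * m + 2 ≤ M →
        |(∑ k ∈ range (2 * m + 2), Dbar ν m k * e k) + alpha0 ν * e (2 * m + 2)|
          ≤ L * h ^ ν * |e (2 * m + 2)| + η) →
      ∀ k ≤ M, |e k| ≤ C * (η / h ^ ν) := by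
  obtain ⟨r, hr, key⟩ := exists_growth_rate h0 h1 hL
  set C3 : ℝ := 24 + 3 * (24 * (|Dco ν 1 1| + |Dco ν 1 2|) + 1) with hC3
  have hC3pos : 24 ≤ C3 := by
    have : 0 ≤ 3 * (24 * (|Dco ν 1 1| + |Dco ν 1 2|) + 1) := by positivity
    linarith
  refine ⟨3 * ((2 + 2 * C3) / L) * exp (r * T), by positivity, ?_⟩
  intro M h η e hh hMT hκ hη he0 hb1 hb2 hodd heven
  set κ := L * h ^ ν with hκd
  have hκ0 : 0 < κ := by positivity
  have h12 := initial_bound h0 h1 hκ hb1 hb2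
  have hn1 := abs_nonneg (e 1)
  have hn2 := abs_nonneg (e 2)
  have hsmall : ∀ k ≤ M, k ≤ 3 → |e k| ≤ C3 * η := by
    intro k hkM hk
    have hC : 24 * η ≤ C3 * η := mul_le_mul_of_nonneg_right hC3pos hη
    interval_cases k
    · rw [he0, abs_zero]; positivity
    · linarith
    · linarith
    · have := third_bound h0 h1 hκ hη he0 (by linarith) (by linarith) (hodd 1 le_rfl hkM)
      rw [hC3]
      linarith
  set A := (2 + 2 * C3) * η / κ with hAd
  set B := A / (1 - theta ν) with hBd
  have hθ0 := theta_nonneg h0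
  have hθ1 := theta_le h0 h1
  have hA0 : 0 ≤ A := by positivity
  have hκA : κ * A = (2 + 2 * C3) * η := by rw [hAd]; field_simp
  have hAB : A = B * (1 - theta ν) := by
    rw [hBd, div_mul_cancel₀]; linarith
  have hB0 : 0 ≤ B := div_nonneg hA0 (by linarith)
  have hAleB : A ≤ B := by rw [hAB]; nlinarith
  have hBle : B ≤ 3 * A := by nlinarith
  have hηA : 2 * η ≤ κ * A := by
    rw [hκA]; nlinarith
  have hCA : 2 * (C3 * η) ≤ A := by
    have : κ * A ≤ A := by nlinarith
    linarith
  set E := exp (r * h) with hEd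
  have hE : 1 ≤ E := one_le_exp (by positivity)
  have main : ∀ k ≤ M, (1 ≤ k → |e k - theta ν * e (k - 1)| ≤ A * E ^ k) ∧
      |e k| ≤ B * E ^ k := by
    intro k
    induction k using Nat.strong_induction_on with
    | _ n ih =>
      intro hnM
      have hEn : 1 ≤ E ^ n := one_le_pow₀ hE
      by_cases hn : n ≤ 3
      · have hen := hsmall n hnM hn
        refine ⟨fun h1n => ?_, ?_⟩
        · have hen' := hsmall (n - 1) (by omega) (by omega)
          calc |e n - theta ν * e (n - 1)| ≤ |e n| + |theta ν * e (n - 1)| := abs_sub _ _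
            _ = |e n| + theta ν * |e (n - 1)| := by rw [abs_mul, abs_of_nonneg hθ0]
            _ ≤ C3 * η + 1 * (C3 * η) := by
                gcongr; linarith
            _ ≤ A := by linarith
            _ ≤ A * E ^ n := le_mul_of_one_le_right hA0 hEn
        · have : 0 ≤ C3 * η := by positivity
          calc |e n| ≤ B := by linarith
            _ ≤ B * E ^ n := le_mul_of_one_le_right hB0 hEn
      · obtain ⟨p, rfl⟩ : ∃ p, n = p + 2 := ⟨n - 2, by omega⟩
        have hp1 := ih (p + 1) (by omega) (by omega)
        have hrow := normalised_row h0 h1 (by omega) hnM hodd heven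
        have hkey := key h hh hκ p e A B (by omega) hB0 hAB he0
          (by simpa using hp1.1 (by omega)) (fun k hk => (ih k (by omega) (by omega)).2)
        have hlast : theta ν * |e (p + 1)| ≤ theta ν * B * E ^ (p + 2) := by
          rw [mul_assoc]
          refine mul_le_mul_of_nonneg_left (hp1.2.trans ?_) hθ0
          exact mul_le_mul_of_nonneg_left (pow_le_pow_right₀ hE (by omega)) hB0
        have htri : |e (p + 2)| ≤ |e (p + 2) - theta ν * e (p + 1)| + theta ν * |e (p + 1)| := by
          have := abs_add_le (e (p + 2) - theta ν * e (p + 1)) (theta ν * e (p + 1))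
          rwa [sub_add_cancel, abs_mul, abs_of_nonneg hθ0] at this
        have hbar : |e (p + 2) - theta ν * e (p + 1)|
            ≤ A * E ^ (p + 2) * (1 - 7 * κ) + 2 * (κ * |e (p + 2)| + η) := by
          refine le_trans ?_ (add_le_add hkey hrow)
          set S := ∑ k ∈ range (p + 2), dco ν (p + 2) k * e k
          have := abs_add_le (S - theta ν * e (p + 1)) (e (p + 2) - S)
          rwa [sub_add_sub_cancel'] at this
        have hbar' : |e (p + 2) - theta ν * e (p + 1)| ≤ A * E ^ (p + 2) := by
          have hθB : theta ν * B ≤ 2 * A := by nlinarith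
          exact absorb_diagonal hκ0.le hκ hEn hA0 hηA hθB hlast htri hbar
        refine ⟨fun _ => by simpa using hbar', ?_⟩
        calc |e (p + 2)| ≤ A * E ^ (p + 2) + theta ν * B * E ^ (p + 2) := by linarith
          _ = B * E ^ (p + 2) := by rw [hAB]; ring
  intro k hk
  have hEk : E ^ k ≤ exp (r * T) := by
    rw [hEd, ← exp_nat_mul]
    refine exp_le_exp.2 ?_
    calc (k : ℝ) * (r * h) = r * (k * h) := by ring
      _ ≤ r * (M * h) := by gcongr
      _ ≤ r * T := by gcongr
  calc |e k| ≤ B * E ^ k := (main k hk).2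
    _ ≤ 3 * A * exp (r * T) := by gcongr
    _ = 3 * ((2 + 2 * C3) / L) * exp (r * T) * (η / h ^ ν) := by
      rw [hAd, hκd]; field_simp

end stability

section truncation

/-- `Y₁, Y₂, Y₃` are the successive derivatives of `Y` within `S`, and `Y₃` is bounded by `M`. -/
structure ThriceDiffOn (Y Y1 Y2 Y3 : ℝ → ℝ) (M : ℝ) (S : Set ℝ) : Prop where
  first : ∀ t ∈ S, HasDerivWithinAt Y (Y1 t) S t
  second : ∀ t ∈ S, HasDerivWithinAt Y1 (Y2 t) S t
  third : ∀ t ∈ S, HasDerivWithinAt Y2 (Y3 t) S t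
  bound : ∀ t ∈ S, |Y3 t| ≤ M

lemma ThriceDiffOn.mono {Y Y1 Y2 Y3 : ℝ → ℝ} {M : ℝ} {S U : Set ℝ}
    (h : ThriceDiffOn Y Y1 Y2 Y3 M S) (hU : U ⊆ S) : ThriceDiffOn Y Y1 Y2 Y3 M U :=
  ⟨fun t ht => (h.first t (hU ht)).mono hU, fun t ht => (h.second t (hU ht)).mono hU,
    fun t ht => (h.third t (hU ht)).mono hU, fun t ht => h.bound t (hU ht)⟩

lemma abs_le_of_exists_zero {g g' : ℝ → ℝ} {c K : ℝ} (hK : 0 ≤ K)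
    (hg : ∀ t ∈ Set.Icc c (c + 2), HasDerivWithinAt g (g' t) (Set.Icc c (c + 2)) t)
    (hb : ∀ t ∈ Set.Icc c (c + 2), |g' t| ≤ K) (hz : ∃ x ∈ Set.Icc c (c + 2), g x = 0)
    {t : ℝ} (ht : t ∈ Set.Icc c (c + 2)) : |g t| ≤ 2 * K := by
  obtain ⟨x, hx, hgx⟩ := hz
  have := (convex_Icc c (c + 2)).norm_image_sub_le_of_norm_hasDerivWithin_le hg hb hx ht
  rw [hgx, sub_zero, Real.norm_eq_abs, Real.norm_eq_abs] at this
  have h2 : |t - x| ≤ 2 := by rw [abs_le]; constructor <;> linarith [hx.1, hx.2, ht.1, ht.2]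
  nlinarith

lemma exists_deriv_zero {g g' : ℝ → ℝ} {S : Set ℝ} {a b : ℝ} (hab : a < b)
    (hS : Set.Icc a b ⊆ S) (hg : ∀ t ∈ S, HasDerivWithinAt g (g' t) S t) (h : g a = g b) :
    ∃ x ∈ Set.Ioo a b, g' x = 0 := by
  refine exists_hasDerivAt_eq_zero hab
    (fun t ht => ((hg t (hS ht)).mono hS).continuousWithinAt) h fun t ht => ?_
  exact ((hg t (hS (Set.Ioo_subset_Icc_self ht))).mono hS).hasDerivAt (Icc_mem_nhds ht.1 ht.2)

/-- Error of quadratic interpolation at three consecutive integers, and of its derivative. -/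
lemma ThriceDiffOn.interp_error {E E1 E2 E3 : ℝ → ℝ} {M c : ℝ}
    (h : ThriceDiffOn E E1 E2 E3 M (Set.Icc c (c + 2))) (z0 : E c = 0) (z1 : E (c + 1) = 0)
    (z2 : E (c + 2) = 0) {t : ℝ} (ht : t ∈ Set.Icc c (c + 2)) :
    |E t| ≤ 8 * M ∧ |E1 t| ≤ 4 * M := by
  have hM : 0 ≤ M := (abs_nonneg _).trans (h.bound t ht)
  obtain ⟨x, hx, hx0⟩ := exists_deriv_zero (show c < c + 1 by linarith)
    (Set.Icc_subset_Icc_right (by linarith)) h.first (z0.trans z1.symm)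
  obtain ⟨w, hw, hw0⟩ := exists_deriv_zero (show c + 1 < c + 2 by linarith)
    (Set.Icc_subset_Icc_left (by linarith)) h.first (z1.trans z2.symm)
  obtain ⟨v, hv, hv0⟩ := exists_deriv_zero (hx.2.trans hw.1)
    (Set.Icc_subset_Icc hx.1.le hw.2.le) h.second (hx0.trans hw0.symm)
  have b2 : ∀ t ∈ Set.Icc c (c + 2), |E2 t| ≤ 2 * M := fun t ht =>
    abs_le_of_exists_zero hM h.third h.bound
      ⟨v, ⟨by linarith [hx.1, hv.1], by linarith [hw.2, hv.2]⟩, hv0⟩ ht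
  have b1 : ∀ t ∈ Set.Icc c (c + 2), |E1 t| ≤ 4 * M := fun t ht => by
    have := abs_le_of_exists_zero (by positivity) h.second b2
      ⟨x, ⟨hx.1.le, by linarith [hx.2]⟩, hx0⟩ ht
    linarith
  have b0 := abs_le_of_exists_zero (by positivity) h.first b1
    ⟨c, ⟨le_rfl, by linarith⟩, z0⟩ ht
  exact ⟨by linarith, b1 t ht⟩

lemma ThriceDiffOn.sub_quadratic {Y Y1 Y2 Y3 : ℝ → ℝ} {M : ℝ} {S : Set ℝ}
    (h : ThriceDiffOn Y Y1 Y2 Y3 M S) (c z p s : ℝ) :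
    ThriceDiffOn (fun t => Y t - (z + p * (t - c) + s * ((t - c) ^ 2 / 2)))
      (fun t => Y1 t - (p + s * (t - c))) (fun t => Y2 t - s) Y3 M S where
  first t ht := by
    have hs := (hasDerivAt_id' t).sub_const c
    refine (h.first t ht).sub (HasDerivAt.hasDerivWithinAt ?_)
    refine (((hs.const_mul p).const_add z).add
      (((hs.pow 2).div_const 2).const_mul s)).congr_deriv ?_
    norm_num
  second t ht := by
    have hs := (hasDerivAt_id' t).sub_const c
    refine (h.second t ht).sub (HasDerivAt.hasDerivWithinAt ?_)
    exact ((hs.const_mul s).const_add p).congr_deriv (by ring)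
  third t ht := by simpa using (h.third t ht).sub_const s
  bound := h.bound

variable {ν : ℝ}

lemma intervalIntegrable_kernel (h1 : ν < 1) (n a b : ℝ) :
    IntervalIntegrable (fun t : ℝ => (n - t) ^ (-ν)) MeasureTheory.volume a b := by
  have := (intervalIntegral.intervalIntegrable_rpow' (r := -ν) (a := n - a) (b := n - b)
    (by linarith)).comp_sub_left n
  simpa using this

lemma segQuad_eq_integral (h0 : 0 < ν) (h1 : ν < 1) {a b : ℝ} (ha : 0 ≤ a) (hab : a ≤ b)
    (n p s : ℝ) : segQuad ν a b p s = 1 / Real.Gamma (1 - ν) *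
      ∫ t in (n - b)..(n - a), (n - t) ^ (-ν) * (p + s * (t - (n - b))) := by
  have hG : 0 < Real.Gamma (1 - ν) := Real.Gamma_pos_of_pos (by linarith)
  have hG3 : Real.Gamma (3 - ν) = (2 - ν) * ((1 - ν) * Real.Gamma (1 - ν)) := by
    rw [← Real.Gamma_add_one (show 1 - ν ≠ 0 by linarith), show 1 - ν + 1 = 2 - ν by ring,
      ← Real.Gamma_add_one (show 2 - ν ≠ 0 by linarith), show 2 - ν + 1 = 3 - ν by ring]
  have e1 : ∫ t in (n - b)..(n - a), (n - t) ^ (-ν) * (p + s * (t - (n - b)))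
      = ∫ u in a..b, u ^ (-ν) * (p + s * (b - u)) := by
    have := intervalIntegral.integral_comp_sub_left (a := n - b) (b := n - a)
      (fun u : ℝ => u ^ (-ν) * (p + s * (b - u))) n
    rw [sub_sub_cancel, sub_sub_cancel] at this
    rw [← this]
    refine intervalIntegral.integral_congr fun t _ => ?_
    ring
  have e2 : ∫ u in a..b, u ^ (-ν) * (p + s * (b - u))
      = ∫ u in a..b, ((p + s * b) * u ^ (-ν) - s * u ^ (1 - ν)) := by
    refine intervalIntegral.integral_congr fun u hu => ?_
    rw [Set.uIcc_of_le hab] at hu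
    have : u ^ (1 - ν) = u * u ^ (-ν) := by
      rw [sub_eq_add_neg, Real.rpow_one_add' (ha.trans hu.1) (by linarith)]
    simp only [this]
    ring
  have i1 : IntervalIntegrable (fun u : ℝ => u ^ (-ν)) MeasureTheory.volume a b :=
    intervalIntegral.intervalIntegrable_rpow' (by linarith)
  have i2 : IntervalIntegrable (fun u : ℝ => u ^ (1 - ν)) MeasureTheory.volume a b :=
    intervalIntegral.intervalIntegrable_rpow' (by linarith)
  have pw : ∀ u : ℝ, 0 ≤ u → u ^ (2 - ν) = u * u ^ (1 - ν) := fun u hu => by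
    rw [← Real.rpow_one_add' hu (by linarith)]; congr 1; ring
  rw [e1, e2, intervalIntegral.integral_sub (i1.const_mul _) (i2.const_mul _),
    intervalIntegral.integral_const_mul, intervalIntegral.integral_const_mul,
    integral_rpow (Or.inl (by linarith)), integral_rpow (Or.inl (by linarith)),
    show -ν + 1 = 1 - ν by ring, show 1 - ν + 1 = 2 - ν by ring, pw a ha, pw b (ha.trans hab),
    segQuad, pw a ha, pw b (ha.trans hab), hG3]
  have : 1 - ν ≠ 0 := by linarith
  have : 2 - ν ≠ 0 := by linarith
  field_simp
  ring

lemma kernel_continuousOn {n c d : ℝ} (hd : d < n) (r : ℝ) :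
    ContinuousOn (fun t : ℝ => (n - t) ^ r) (Set.Icc c d) :=
  ContinuousOn.rpow_const (by fun_prop) fun t ht => Or.inl (by linarith [ht.2])

lemma kernel_hasDerivAt {n t : ℝ} (ht : t < n) :
    HasDerivAt (fun t : ℝ => (n - t) ^ (-ν)) (ν * (n - t) ^ (-ν - 1)) t := by
  have := (Real.hasDerivAt_rpow_const (x := n - t) (p := -ν) (Or.inl (by linarith))).comp t
    ((hasDerivAt_id' t).const_sub n)
  exact this.congr_deriv (by ring)

lemma far_segment_bound (h0 : 0 < ν) {E E1 : ℝ → ℝ} {n c d K : ℝ} (hcd : c ≤ d) (hd : d < n)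
    (hE : ∀ t ∈ Set.Icc c d, HasDerivWithinAt E (E1 t) (Set.Icc c d) t)
    (hE1 : ContinuousOn E1 (Set.Icc c d)) (zc : E c = 0) (zd : E d = 0)
    (hK : ∀ t ∈ Set.Icc c d, |E t| ≤ K) :
    |∫ t in c..d, (n - t) ^ (-ν) * E1 t| ≤ K * ((n - d) ^ (-ν) - (n - c) ^ (-ν)) := by
  have hu : Set.uIcc c d = Set.Icc c d := Set.uIcc_of_le hcd
  have hder : ∀ t ∈ Set.uIcc c d, HasDerivAt (fun t : ℝ => (n - t) ^ (-ν))
      (ν * (n - t) ^ (-ν - 1)) t := fun t ht => by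
    rw [hu] at ht
    exact kernel_hasDerivAt (ht.2.trans_lt hd)
  have hci : IntervalIntegrable (fun t : ℝ => ν * (n - t) ^ (-ν - 1)) MeasureTheory.volume c d :=
    ContinuousOn.intervalIntegrable (by rw [hu]; exact (kernel_continuousOn hd _).const_mul ν)
  have hparts := intervalIntegral.integral_mul_deriv_eq_deriv_mul_of_hasDerivWithinAt
    (a := c) (b := d) (u := fun t : ℝ => (n - t) ^ (-ν)) (v := E) (v' := E1)
    (fun t ht => (hder t ht).hasDerivWithinAt) (by rw [hu]; exact hE) hci
    (ContinuousOn.intervalIntegrable (by rw [hu]; exact hE1))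
  have hFTC := intervalIntegral.integral_eq_sub_of_hasDerivAt hder hci
  simp only [zc, zd, mul_zero, sub_zero, zero_sub] at hparts
  rw [hparts, abs_neg, ← hFTC, ← intervalIntegral.integral_const_mul, ← Real.norm_eq_abs]
  refine intervalIntegral.norm_integral_le_of_norm_le hcd
    (Filter.Eventually.of_forall fun t ht => ?_) (hci.const_mul K)
  have hnt : 0 < n - t := by linarith [ht.2]
  rw [Real.norm_eq_abs, abs_mul, abs_of_pos (by positivity), mul_comm]
  exact mul_le_mul_of_nonneg_right (hK t ⟨ht.1.le, ht.2⟩) (by positivity)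

lemma last_segment_bound (h1 : ν < 1) {E1 : ℝ → ℝ} {n c K : ℝ} (hc : c ≤ n)
    (hK : ∀ t ∈ Set.Icc c n, |E1 t| ≤ K) :
    |∫ t in c..n, (n - t) ^ (-ν) * E1 t| ≤ K * ((n - c) ^ (1 - ν) / (1 - ν)) := by
  have hint : ∫ t in c..n, (n - t) ^ (-ν) = (n - c) ^ (1 - ν) / (1 - ν) := by
    rw [intervalIntegral.integral_comp_sub_left (fun u : ℝ => u ^ (-ν)) n, sub_self,
      integral_rpow (Or.inl (by linarith)), show -ν + 1 = 1 - ν by ring,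
      Real.zero_rpow (by linarith), sub_zero]
  rw [← hint, ← intervalIntegral.integral_const_mul, ← Real.norm_eq_abs]
  refine intervalIntegral.norm_integral_le_of_norm_le hc
    (Filter.Eventually.of_forall fun t ht => ?_) ((intervalIntegrable_kernel h1 n c n).const_mul K)
  have hnt : 0 ≤ n - t := by linarith [ht.2]
  rw [Real.norm_eq_abs, abs_mul, abs_of_nonneg (by positivity), mul_comm]
  exact mul_le_mul_of_nonneg_right (hK t ⟨ht.1.le, ht.2⟩) (by positivity)

end truncation

section truncation
variable {ν : ℝ}

lemma slope0_natCast (Y : ℝ → ℝ) (k : ℕ) : slope0 (fun j => Y j) k =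
    (-3 * Y k + 4 * Y (k + 1) - Y (k + 2)) / 2 := by
  simp [slope0]

lemma curv_natCast (Y : ℝ → ℝ) (k : ℕ) : curv (fun j => Y j) k =
    Y k - 2 * Y (k + 1) + Y (k + 2) := by
  simp [curv]

/-- Weighted integral of `g` over the segment from `c` to `d` in the fractional derivative
at `n`. -/
noncomputable def kernelIntegral (ν n : ℝ) (g : ℝ → ℝ) (c d : ℝ) : ℝ :=
  1 / Real.Gamma (1 - ν) * ∫ t in c..d, (n - t) ^ (-ν) * g t

lemma kernel_mul_intervalIntegrable (h1 : ν < 1) {g : ℝ → ℝ} (n : ℝ) {c d : ℝ} (hcd : c ≤ d)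
    (hg : ContinuousOn g (Set.Icc c d)) :
    IntervalIntegrable (fun t => (n - t) ^ (-ν) * g t) MeasureTheory.volume c d :=
  (intervalIntegrable_kernel h1 n c d).mul_continuousOn (by rwa [Set.uIcc_of_le hcd])

lemma kernelIntegral_sub_segQuad (h0 : 0 < ν) (h1 : ν < 1) {g : ℝ → ℝ} {n c d : ℝ}
    (hcd : c ≤ d) (hdn : d ≤ n) (hg : ContinuousOn g (Set.Icc c d)) (p s : ℝ) :
    kernelIntegral ν n g c d - segQuad ν (n - d) (n - c) p s =
      kernelIntegral ν n (fun t => g t - (p + s * (t - c))) c d := by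
  rw [segQuad_eq_integral h0 h1 (by linarith) (by linarith) n, kernelIntegral, kernelIntegral,
    sub_sub_cancel, sub_sub_cancel, ← mul_sub, ← intervalIntegral.integral_sub
      (kernel_mul_intervalIntegrable h1 n hcd hg)
      (kernel_mul_intervalIntegrable h1 n hcd (by fun_prop))]
  simp only [mul_sub]

section segment
variable {Y Y1 Y2 Y3 : ℝ → ℝ} {M : ℝ}

lemma ThriceDiffOn.continuousOn_first {S : Set ℝ} (h : ThriceDiffOn Y Y1 Y2 Y3 M S) :
    ContinuousOn Y1 S := fun t ht => (h.second t ht).continuousWithinAt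

lemma segment_error_far (h0 : 0 < ν) (h1 : ν < 1) {k : ℕ} {n d : ℝ}
    (h : ThriceDiffOn Y Y1 Y2 Y3 M (Set.Icc (k : ℝ) (k + 2)))
    (hd : d = k + 1 ∨ d = k + 2) (hdn : d < n) :
    |kernelIntegral ν n Y1 k d
        - segQuad ν (n - d) (n - k) (slope0 (fun j => Y j) k) (curv (fun j => Y j) k)|
      ≤ 1 / Real.Gamma (1 - ν) * (8 * M) * ((n - d) ^ (-ν) - (n - k) ^ (-ν)) := by
  have hG : 0 < Real.Gamma (1 - ν) := Real.Gamma_pos_of_pos (by linarith)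
  have hkd : (k : ℝ) ≤ d := by rcases hd with rfl | rfl <;> linarith
  have hsub : Set.Icc (k : ℝ) d ⊆ Set.Icc (k : ℝ) (k + 2) :=
    Set.Icc_subset_Icc_right (by rcases hd with rfl | rfl <;> linarith)
  rw [kernelIntegral_sub_segQuad h0 h1 hkd hdn.le (h.continuousOn_first.mono hsub),
    slope0_natCast, curv_natCast]
  set p := (-3 * Y k + 4 * Y (k + 1) - Y (k + 2)) / 2 with hp
  set s := Y k - 2 * Y (k + 1) + Y (k + 2) with hs
  have hE := h.sub_quadratic k (Y k) p s
  have z0 : Y k - (Y k + p * (k - k) + s * ((k - k : ℝ) ^ 2 / 2)) = 0 := by ring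
  have z1 : Y (k + 1) - (Y k + p * (k + 1 - k) + s * ((k + 1 - k : ℝ) ^ 2 / 2)) = 0 := by
    rw [hp, hs]; ring
  have z2 : Y (k + 2) - (Y k + p * (k + 2 - k) + s * ((k + 2 - k : ℝ) ^ 2 / 2)) = 0 := by
    rw [hp, hs]; ring
  rw [kernelIntegral, abs_mul, abs_of_pos (by positivity), mul_assoc]
  refine mul_le_mul_of_nonneg_left ?_ (by positivity)
  refine far_segment_bound h0 hkd hdn (hE.mono hsub).first (hE.mono hsub).continuousOn_first
    z0 ?_ fun t ht => (hE.interp_error z0 z1 z2 (hsub ht)).1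
  rcases hd with rfl | rfl
  · exact z1
  · exact z2

lemma segment_error_last (h0 : 0 < ν) (h1 : ν < 1) {k : ℕ} {n : ℝ}
    (h : ThriceDiffOn Y Y1 Y2 Y3 M (Set.Icc (k : ℝ) (k + 2)))
    (hn : n = k + 1 ∨ n = k + 2) :
    |kernelIntegral ν n Y1 k n
        - segQuad ν 0 (n - k) (slope0 (fun j => Y j) k) (curv (fun j => Y j) k)|
      ≤ 1 / Real.Gamma (1 - ν) * (8 / (1 - ν) * M) := by
  have hG : 0 < Real.Gamma (1 - ν) := Real.Gamma_pos_of_pos (by linarith)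
  have hkn : (k : ℝ) ≤ n := by rcases hn with rfl | rfl <;> linarith
  have hn2 : n - k ≤ 2 := by rcases hn with rfl | rfl <;> linarith
  have hsub : Set.Icc (k : ℝ) n ⊆ Set.Icc (k : ℝ) (k + 2) :=
    Set.Icc_subset_Icc_right (by linarith)
  have hM : 0 ≤ M := (abs_nonneg _).trans (h.bound k ⟨le_rfl, by linarith⟩)
  have := kernelIntegral_sub_segQuad h0 h1 hkn le_rfl (h.continuousOn_first.mono hsub)
  rw [sub_self] at this
  rw [this, slope0_natCast, curv_natCast]
  set p := (-3 * Y k + 4 * Y (k + 1) - Y (k + 2)) / 2 with hp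
  set s := Y k - 2 * Y (k + 1) + Y (k + 2) with hs
  have hE := h.sub_quadratic k (Y k) p s
  have z0 : Y k - (Y k + p * (k - k) + s * ((k - k : ℝ) ^ 2 / 2)) = 0 := by ring
  have z1 : Y (k + 1) - (Y k + p * (k + 1 - k) + s * ((k + 1 - k : ℝ) ^ 2 / 2)) = 0 := by
    rw [hp, hs]; ring
  have z2 : Y (k + 2) - (Y k + p * (k + 2 - k) + s * ((k + 2 - k : ℝ) ^ 2 / 2)) = 0 := by
    rw [hp, hs]; ring
  have hpow : (n - k) ^ (1 - ν) ≤ 2 := by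
    calc (n - k) ^ (1 - ν) ≤ (2 : ℝ) ^ (1 - ν) :=
          Real.rpow_le_rpow (by linarith) hn2 (by linarith)
      _ ≤ (2 : ℝ) ^ (1 : ℝ) := Real.rpow_le_rpow_of_exponent_le one_le_two (by linarith)
      _ = 2 := Real.rpow_one 2
  rw [kernelIntegral, abs_mul, abs_of_pos (by positivity)]
  refine mul_le_mul_of_nonneg_left ?_ (by positivity)
  refine (last_segment_bound h1 hkn
    fun t ht => (hE.interp_error z0 z1 z2 (hsub ht)).2).trans ?_
  have h1' : 0 < 1 - ν := by linarith
  calc 4 * M * ((n - k) ^ (1 - ν) / (1 - ν)) ≤ 4 * M * (2 / (1 - ν)) := by gcongr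
    _ = 8 / (1 - ν) * M := by ring

end segment

/-- Constant in the truncation error of the scheme on the unit grid. -/
noncomputable def truncConst (ν : ℝ) : ℝ :=
  1 / Real.Gamma (1 - ν) * (16 + 8 / (1 - ν))

lemma truncConst_pos (h1 : ν < 1) : 0 < truncConst ν := by
  have hG : 0 < Real.Gamma (1 - ν) := Real.Gamma_pos_of_pos (by linarith)
  have : 0 < 1 - ν := by linarith
  unfold truncConst; positivity

lemma kernelIntegral_split (h1 : ν < 1) {g : ℝ → ℝ} {n c : ℝ} (m : ℕ)
    (hg : ContinuousOn g (Set.Icc c (c + 2 * m))) :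
    kernelIntegral ν n g c (c + 2 * m) =
      ∑ q ∈ range m, kernelIntegral ν n g (c + 2 * q) (c + 2 * q + 2) := by
  have hint : ∀ q < m, IntervalIntegrable (fun t => (n - t) ^ (-ν) * g t)
      MeasureTheory.volume (c + 2 * (q : ℕ)) (c + 2 * ((q + 1 : ℕ) : ℝ)) := fun q hq => by
    have hq' : ((q + 1 : ℕ) : ℝ) ≤ m := by exact_mod_cast hq
    have hq0 : (0 : ℝ) ≤ q := q.cast_nonneg
    push_cast at hq' ⊢
    exact kernel_mul_intervalIntegrable h1 n (by linarith)
      (hg.mono (Set.Icc_subset_Icc (by linarith) (by linarith)))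
  have := intervalIntegral.sum_integral_adjacent_intervals
    (a := fun q : ℕ => c + 2 * (q : ℝ)) hint
  simp only [Nat.cast_zero, mul_zero, add_zero] at this
  simp only [kernelIntegral]
  rw [← this, mul_sum]
  refine sum_congr rfl fun q _ => ?_
  push_cast
  rw [mul_add, mul_one, add_assoc]

section total
variable {Y Y1 Y2 Y3 : ℝ → ℝ} {M R : ℝ}

lemma far_segments_error (h0 : 0 < ν) (h1 : ν < 1) {i m : ℕ} {n : ℝ}
    (h : ThriceDiffOn Y Y1 Y2 Y3 M (Set.Icc 0 R)) (hn : n = i + 2 * m + 2) (hnR : n ≤ R) :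
    |∑ q ∈ range m, (kernelIntegral ν n Y1 (i + 2 * q) (i + 2 * q + 2)
        - segQuad ν (n - (i + 2 * q + 2)) (n - (i + 2 * q))
          (slope0 (fun j => Y j) (i + 2 * q)) (curv (fun j => Y j) (i + 2 * q)))|
      ≤ 1 / Real.Gamma (1 - ν) * (8 * M) := by
  have hG : 0 < Real.Gamma (1 - ν) := Real.Gamma_pos_of_pos (by linarith)
  have hm0 : (0 : ℝ) ≤ m := m.cast_nonneg
  have hi0 : (0 : ℝ) ≤ i := i.cast_nonneg
  have hM : 0 ≤ M := (abs_nonneg _).trans (h.bound 0 ⟨le_rfl, by linarith⟩)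
  have hseg : ∀ q ∈ range m, |kernelIntegral ν n Y1 (i + 2 * q) (i + 2 * q + 2)
        - segQuad ν (n - (i + 2 * q + 2)) (n - (i + 2 * q))
          (slope0 (fun j => Y j) (i + 2 * q)) (curv (fun j => Y j) (i + 2 * q))|
      ≤ 1 / Real.Gamma (1 - ν) * (8 * M) * ((n - (i + 2 * ((q + 1 : ℕ) : ℝ))) ^ (-ν)
        - (n - (i + 2 * (q : ℝ))) ^ (-ν)) := by
    intro q hq
    have hq' : ((q + 1 : ℕ) : ℝ) ≤ m := by exact_mod_cast mem_range.1 hq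
    push_cast at hq'
    have hq0 : (0 : ℝ) ≤ q := q.cast_nonneg
    have := segment_error_far (k := i + 2 * q) (n := n) (d := i + 2 * q + 2) h0 h1
      (h.mono (Set.Icc_subset_Icc (by positivity) (by push_cast; linarith)))
      (Or.inr (by push_cast; ring)) (by linarith)
    push_cast at this ⊢
    rwa [show (i : ℝ) + 2 * (q + 1) = i + 2 * q + 2 by ring]
  refine (abs_sum_le_sum_abs _ _).trans ((sum_le_sum hseg).trans ?_)
  rw [← mul_sum, sum_range_sub (fun q : ℕ => (n - (i + 2 * (q : ℝ))) ^ (-ν))]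
  refine mul_le_of_le_one_right (by positivity) ?_
  have e1 : (n - (i + 2 * (m : ℝ))) ^ (-ν) ≤ 1 :=
    Real.rpow_le_one_of_one_le_of_nonpos (by linarith) (by linarith)
  have e2 : 0 ≤ (n - (i + 2 * ((0 : ℕ) : ℝ))) ^ (-ν) :=
    Real.rpow_nonneg (by push_cast; linarith) _
  linarith

lemma blocks_error (h0 : 0 < ν) (h1 : ν < 1) {i m : ℕ} {n : ℝ}
    (h : ThriceDiffOn Y Y1 Y2 Y3 M (Set.Icc 0 R)) (hn : n = i + 2 * m + 2) (hnR : n ≤ R) :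
    |kernelIntegral ν n Y1 i n - ∑ q ∈ range (m + 1),
        segQuad ν (n - (i + 2 * q + 2)) (n - (i + 2 * q))
          (slope0 (fun j => Y j) (i + 2 * q)) (curv (fun j => Y j) (i + 2 * q))|
      ≤ 1 / Real.Gamma (1 - ν) * (8 * M) + 1 / Real.Gamma (1 - ν) * (8 / (1 - ν) * M) := by
  have hm0 : (0 : ℝ) ≤ m := m.cast_nonneg
  have hi0 : (0 : ℝ) ≤ i := i.cast_nonneg
  have hsplit := kernelIntegral_split (ν := ν) (n := n) (g := Y1) (c := i) h1 (m + 1)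
    (h.continuousOn_first.mono (Set.Icc_subset_Icc hi0 (by push_cast; linarith)))
  rw [show (i : ℝ) + 2 * ((m + 1 : ℕ) : ℝ) = n by push_cast; linarith] at hsplit
  rw [hsplit, ← sum_sub_distrib, sum_range_succ]
  refine (abs_add_le _ _).trans (add_le_add (far_segments_error h0 h1 h hn hnR) ?_)
  have := segment_error_last (k := i + 2 * m) (n := n) h0 h1
    (h.mono (Set.Icc_subset_Icc (by positivity) (by push_cast; linarith)))
    (Or.inr (by push_cast; linarith))
  push_cast at this
  rwa [show (i : ℝ) + 2 * m + 2 = n by linarith, sub_self]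

lemma truncation_one (h0 : 0 < ν) (h1 : ν < 1)
    (h : ThriceDiffOn Y Y1 Y2 Y3 M (Set.Icc 0 R)) (hR : 2 ≤ R) :
    |kernelIntegral ν 1 Y1 0 1 - (Dhat0 ν * Y 0 + Dhat1 ν * Y 1 + Dhat2 ν * Y 2)|
      ≤ truncConst ν * M := by
  have hG : 0 < Real.Gamma (1 - ν) := Real.Gamma_pos_of_pos (by linarith)
  have hM : 0 ≤ M := (abs_nonneg _).trans (h.bound 0 ⟨le_rfl, by linarith⟩)
  have h2 := initial_one h0 h1 (fun j : ℕ => Y j)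
  have h3 := segment_error_last (k := 0) (n := 1) h0 h1
    (h.mono (Set.Icc_subset_Icc (by simp) (by simpa))) (Or.inl (by simp))
  simp only [Nat.cast_zero, Nat.cast_one, Nat.cast_ofNat, sub_zero] at h2 h3
  rw [h2]
  refine h3.trans ?_
  rw [truncConst, mul_assoc]
  refine mul_le_mul_of_nonneg_left ?_ (by positivity)
  linarith

lemma truncation_two (h0 : 0 < ν) (h1 : ν < 1)
    (h : ThriceDiffOn Y Y1 Y2 Y3 M (Set.Icc 0 R)) (hR : 2 ≤ R) :
    |kernelIntegral ν 2 Y1 0 2 - (Dtil0 ν * Y 0 + Dtil1 ν * Y 1 + Dtil2 ν * Y 2)|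
      ≤ truncConst ν * M := by
  have hG : 0 < Real.Gamma (1 - ν) := Real.Gamma_pos_of_pos (by linarith)
  have hM : 0 ≤ M := (abs_nonneg _).trans (h.bound 0 ⟨le_rfl, by linarith⟩)
  have h2 := initial_two h0 h1 (fun j : ℕ => Y j)
  have h3 := segment_error_last (k := 0) (n := 2) h0 h1
    (h.mono (Set.Icc_subset_Icc (by simp) (by simpa))) (Or.inr (by simp))
  simp only [Nat.cast_zero, Nat.cast_one, Nat.cast_ofNat, sub_zero] at h2 h3
  rw [h2]
  refine h3.trans ?_
  rw [truncConst, mul_assoc]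
  refine mul_le_mul_of_nonneg_left ?_ (by positivity)
  linarith

lemma truncation_even (h0 : 0 < ν) (h1 : ν < 1)
    (h : ThriceDiffOn Y Y1 Y2 Y3 M (Set.Icc 0 R)) {m : ℕ} (hm : ((2 * m + 2 : ℕ) : ℝ) ≤ R) :
    |kernelIntegral ν (2 * m + 2 : ℕ) Y1 0 (2 * m + 2 : ℕ)
        - ((∑ k ∈ range (2 * m + 2), Dbar ν m k * Y k) + alpha0 ν * Y (2 * m + 2 : ℕ))|
      ≤ truncConst ν * M := by
  have hG : 0 < Real.Gamma (1 - ν) := Real.Gamma_pos_of_pos (by linarith)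
  have hM : 0 ≤ M := (abs_nonneg _).trans
    (h.bound 0 ⟨le_rfl, (Nat.cast_nonneg _).trans hm⟩)
  have h2 := sum_Dbar_eq h0 h1 m (fun j : ℕ => Y j)
  have h3 := blocks_error (i := 0) (m := m) h0 h1 h (by push_cast; ring) hm
  rw [h2]
  have e : ∑ q ∈ range (m + 1), segQuad ν (2 * m - 2 * q) (2 * m - 2 * q + 2)
        (slope0 (fun j => Y j) (2 * q)) (curv (fun j => Y j) (2 * q))
      = ∑ q ∈ range (m + 1), segQuad ν ((2 * m + 2 : ℕ) - ((0 : ℕ) + 2 * q + 2))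
        ((2 * m + 2 : ℕ) - ((0 : ℕ) + 2 * q))
        (slope0 (fun j => Y j) (0 + 2 * q)) (curv (fun j => Y j) (0 + 2 * q)) := by
    refine sum_congr rfl fun q _ => ?_
    rw [zero_add]
    congr 1 <;> push_cast <;> ring
  rw [e]
  simp only [Nat.cast_zero] at h3 ⊢
  refine h3.trans ?_
  rw [truncConst, mul_assoc, ← mul_add]
  refine mul_le_mul_of_nonneg_left ?_ (by positivity)
  linarith

lemma truncation_odd (h0 : 0 < ν) (h1 : ν < 1)
    (h : ThriceDiffOn Y Y1 Y2 Y3 M (Set.Icc 0 R)) {m : ℕ} (hm1 : 1 ≤ m)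
    (hm : ((2 * m + 1 : ℕ) : ℝ) ≤ R) :
    |kernelIntegral ν (2 * m + 1 : ℕ) Y1 0 (2 * m + 1 : ℕ)
        - ((∑ k ∈ range (2 * m + 1), Dco ν m k * Y k) + alpha0 ν * Y (2 * m + 1 : ℕ))|
      ≤ truncConst ν * M := by
  have hG : 0 < Real.Gamma (1 - ν) := Real.Gamma_pos_of_pos (by linarith)
  have hM : 0 ≤ M := (abs_nonneg _).trans
    (h.bound 0 ⟨le_rfl, (Nat.cast_nonneg _).trans hm⟩)
  have hm1' : (1 : ℝ) ≤ m := by exact_mod_cast hm1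
  have h2 := sum_Dco_eq h0 h1 hm1 (fun j : ℕ => Y j)
  obtain ⟨l, rfl⟩ : ∃ l, m = l + 1 := ⟨m - 1, by omega⟩
  set n : ℝ := ((2 * (l + 1) + 1 : ℕ) : ℝ) with hn
  have hn' : n = 2 * l + 3 := by rw [hn]; push_cast; ring
  have hl0 : (0 : ℝ) ≤ l := l.cast_nonneg
  have h3 := blocks_error (i := 1) (m := l) h0 h1 h (by rw [hn']; push_cast; ring) hm
  have h4 := segment_error_far (k := 0) (d := 1) (n := n) h0 h1
    (h.mono (Set.Icc_subset_Icc (by simp) (by push_cast; linarith))) (Or.inl (by simp))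
    (by linarith)
  have h5 : kernelIntegral ν n Y1 0 n
      = kernelIntegral ν n Y1 0 1 + kernelIntegral ν n Y1 1 n := by
    simp only [kernelIntegral]
    rw [← mul_add, intervalIntegral.integral_add_adjacent_intervals]
    · exact kernel_mul_intervalIntegrable h1 n zero_le_one
        (h.continuousOn_first.mono (Set.Icc_subset_Icc_right (by linarith)))
    · exact kernel_mul_intervalIntegrable h1 n (by linarith)
        (h.continuousOn_first.mono (Set.Icc_subset_Icc zero_le_one (by linarith)))
  have e : ∑ q ∈ range (l + 1), segQuad ν (2 * (l + 1 : ℕ) - 2 - 2 * q) (2 * (l + 1 : ℕ) - 2 * q)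
        (slope0 (fun j => Y j) (2 * q + 1)) (curv (fun j => Y j) (2 * q + 1))
      = ∑ q ∈ range (l + 1), segQuad ν (n - ((1 : ℕ) + 2 * q + 2)) (n - ((1 : ℕ) + 2 * q))
        (slope0 (fun j => Y j) (1 + 2 * q)) (curv (fun j => Y j) (1 + 2 * q)) := by
    refine sum_congr rfl fun q _ => ?_
    rw [add_comm (2 * q) 1, hn']
    congr 1 <;> push_cast <;> ring
  rw [h2, e, h5]
  have e' : (2 * ((l + 1 : ℕ) : ℝ)) = n - 1 := by rw [hn']; push_cast; ring
  rw [e', show n - 1 + 1 = n - 0 by ring]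
  simp only [Nat.cast_zero, Nat.cast_one] at h3 h4 ⊢
  have h6 : 1 / Real.Gamma (1 - ν) * (8 * M) * ((n - 1) ^ (-ν) - (n - 0) ^ (-ν))
      ≤ 1 / Real.Gamma (1 - ν) * (8 * M) := by
    refine mul_le_of_le_one_right (by positivity) ?_
    have e1 : (n - 1) ^ (-ν) ≤ 1 :=
      Real.rpow_le_one_of_one_le_of_nonpos (by linarith) (by linarith)
    have e2 : 0 ≤ (n - 0) ^ (-ν) := Real.rpow_nonneg (by linarith) _
    linarith
  rw [add_sub_add_comm]
  refine (abs_add_le _ _).trans ((add_le_add (h4.trans h6) h3).trans (le_of_eq ?_))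
  rw [truncConst]
  ring

end total

end truncation

section convergence
variable {ν : ℝ}

lemma ContDiffOn.exists_thriceDiffOn {y : ℝ → ℝ} {T : ℝ} (hT : 0 < T)
    (hy : ContDiffOn ℝ 3 y (Set.Icc 0 T)) :
    ∃ y1 y2 y3 M, ThriceDiffOn y y1 y2 y3 M (Set.Icc 0 T) := by
  have hu : UniqueDiffOn ℝ (Set.Icc 0 T) := uniqueDiffOn_Icc hT
  have c1 : ContDiffOn ℝ 2 (derivWithin y (Set.Icc 0 T)) (Set.Icc 0 T) :=
    hy.derivWithin hu (by norm_num)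
  have c2 := c1.derivWithin (m := 1) hu (by norm_num)
  have c3 := c2.derivWithin (m := 0) hu (by norm_num)
  obtain ⟨M, hM⟩ := isCompact_Icc.exists_bound_of_continuousOn c3.continuousOn
  exact ⟨_, _, _, M,
    fun t ht => (hy.differentiableOn (by norm_num) t ht).hasDerivWithinAt,
    fun t ht => (c1.differentiableOn (by norm_num) t ht).hasDerivWithinAt,
    fun t ht => (c2.differentiableOn (by norm_num) t ht).hasDerivWithinAt, hM⟩

lemma ThriceDiffOn.comp_mul {y y1 y2 y3 : ℝ → ℝ} {M T R h : ℝ}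
    (hd : ThriceDiffOn y y1 y2 y3 M (Set.Icc 0 T)) (hh : 0 < h) (hR : R * h ≤ T) :
    ThriceDiffOn (fun t => y (t * h)) (fun t => h * y1 (t * h)) (fun t => h ^ 2 * y2 (t * h))
      (fun t => h ^ 3 * y3 (t * h)) (h ^ 3 * M) (Set.Icc 0 R) := by
  have hmaps : Set.MapsTo (fun t : ℝ => t * h) (Set.Icc 0 R) (Set.Icc 0 T) := fun t ht =>
    ⟨mul_nonneg ht.1 hh.le, (mul_le_mul_of_nonneg_right ht.2 hh.le).trans hR⟩
  have comp : ∀ g g' : ℝ → ℝ, (∀ t ∈ Set.Icc 0 T, HasDerivWithinAt g (g' t) (Set.Icc 0 T) t) →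
      ∀ t ∈ Set.Icc 0 R,
        HasDerivWithinAt (fun t => g (t * h)) (h * g' (t * h)) (Set.Icc 0 R) t := by
    intro g g' hg t ht
    have h2 : HasDerivWithinAt (fun t : ℝ => t * h) h (Set.Icc 0 R) t := by
      simpa using ((hasDerivAt_id' t).mul_const h).hasDerivWithinAt
    exact ((hg _ (hmaps ht)).comp t h2 hmaps).congr_deriv (mul_comm _ _)
  refine ⟨comp _ _ hd.first, fun t ht => ?_, fun t ht => ?_, fun t ht => ?_⟩
  · exact ((comp _ _ hd.second t ht).const_mul h).congr_deriv (by ring)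
  · exact ((comp _ _ hd.third t ht).const_mul (h ^ 2)).congr_deriv (by ring)
  · rw [abs_mul, abs_of_pos (by positivity)]
    exact mul_le_mul_of_nonneg_left (hd.bound _ (hmaps ht)) (by positivity)

lemma caputo_eq_kernelIntegral {y y1 : ℝ → ℝ} {T n h : ℝ} (hn : 0 ≤ n) (hh : 0 < h)
    (hnT : n * h ≤ T)
    (hy : ∀ t ∈ Set.Icc 0 T, HasDerivWithinAt y (y1 t) (Set.Icc 0 T) t) :
    caputo ν y (n * h) = h ^ (-ν) * kernelIntegral ν n (fun t => h * y1 (t * h)) 0 n := by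
  have e1 : ∫ s in (0 : ℝ)..(n * h), (n * h - s) ^ (-ν) * deriv y s
      = ∫ s in (0 : ℝ)..(n * h), (n * h - s) ^ (-ν) * y1 s := by
    refine intervalIntegral.integral_congr_Ioo_of_le (by positivity) fun s hs => ?_
    have hs' : s ∈ Set.Icc 0 T := ⟨hs.1.le, hs.2.le.trans hnT⟩
    rw [((hy s hs').hasDerivAt (Icc_mem_nhds hs.1 (hs.2.trans_le hnT))).deriv]
  have e2 := intervalIntegral.smul_integral_comp_mul_right (a := 0) (b := n)
    (fun s => (n * h - s) ^ (-ν) * y1 s) h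
  rw [zero_mul, smul_eq_mul] at e2
  rw [caputo, kernelIntegral, e1, ← e2, mul_left_comm (h ^ (-ν))]
  congr 1
  rw [← intervalIntegral.integral_const_mul, ← intervalIntegral.integral_const_mul]
  refine intervalIntegral.integral_congr fun t ht => ?_
  rw [Set.uIcc_of_le hn] at ht
  rw [← sub_mul, Real.mul_rpow (by linarith [ht.2]) hh.le]
  ring

/-- Comparison of one row of the scheme with the same row for the exact solution. -/
lemma row_error {L h η u v kI S D F G : ℝ} (hh : 0 < h) (htrunc : |kI - S| ≤ η)
    (hexact : h ^ (-ν) * kI = F) (hscheme : h ^ (-ν) * D = G) (hlip : |F - G| ≤ L * |u - v|) :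
    |S - D| ≤ L * h ^ ν * |u - v| + η := by
  have hp : 0 < h ^ ν := by positivity
  have hmul : h ^ ν * h ^ (-ν) = 1 := by
    rw [Real.rpow_neg hh.le, mul_inv_cancel₀ hp.ne']
  have e : S - D = h ^ ν * (F - G) - (kI - S) := by
    rw [← hexact, ← hscheme, mul_sub, ← mul_assoc, ← mul_assoc, hmul]; ring
  rw [e]
  refine (abs_sub _ _).trans (add_le_add ?_ htrunc)
  rw [abs_mul, abs_of_pos hp]
  calc h ^ ν * |F - G| ≤ h ^ ν * (L * |u - v|) := by gcongr
    _ = L * h ^ ν * |u - v| := by ring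

end convergence

theorem stmt15 (ν T L : ℝ) (hν : ν ∈ Set.Ioo (0:ℝ) 1) (hT : 0 < T) (hL : 0 < L)
    (y : ℝ → ℝ) (hy : ContDiffOn ℝ 3 y (Set.Icc 0 T))
    (f : ℝ → ℝ → ℝ)
    (hf : ∀ x ∈ Set.Icc (0:ℝ) T, ∀ u v : ℝ, |f x u - f x v| ≤ L * |u - v|)
    (hode : ∀ x ∈ Set.Ioc (0:ℝ) T, caputo ν y x = f x (y x)) :
    ∃ K > 0, ∀ N : ℕ, 0 < N →
      (T / (2 * (N : ℝ))) ^ ν ≤ 1 / (216 * L) →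
      ∀ ys : ℕ → ℝ, ys 0 = y 0 →
      (T / (2 * (N : ℝ))) ^ (-ν) * (Dhat0 ν * ys 0 + Dhat1 ν * ys 1 + Dhat2 ν * ys 2)
        = f (T / (2 * (N : ℝ))) (ys 1) →
      (T / (2 * (N : ℝ))) ^ (-ν) * (Dtil0 ν * ys 0 + Dtil1 ν * ys 1 + Dtil2 ν * ys 2)
        = f (2 * (T / (2 * (N : ℝ)))) (ys 2) →
      (∀ m : ℕ, 1 ≤ m → 2 * m + 1 ≤ 2 * N →
        (T / (2 * (N : ℝ))) ^ (-ν) * ((∑ k ∈ Finset.range (2 * m + 1), Dco ν m k * ys k)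
            + alpha0 ν * ys (2 * m + 1))
          = f (((2 * m + 1 : ℕ) : ℝ) * (T / (2 * (N : ℝ)))) (ys (2 * m + 1))) →
      (∀ m : ℕ, 1 ≤ m → 2 * m + 2 ≤ 2 * N →
        (T / (2 * (N : ℝ))) ^ (-ν) * ((∑ k ∈ Finset.range (2 * m + 2), Dbar ν m k * ys k)
            + alpha0 ν * ys (2 * m + 2))
          = f (((2 * m + 2 : ℕ) : ℝ) * (T / (2 * (N : ℝ)))) (ys (2 * m + 2))) →
      ∀ k : ℕ, 1 ≤ k → k ≤ 2 * N →
        |y ((k : ℝ) * (T / (2 * (N : ℝ)))) - ys k| ≤ K * (T / (2 * (N : ℝ))) ^ (3 - ν) := by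
  obtain ⟨h0, h1⟩ := hν
  obtain ⟨y1, y2, y3, M, hd⟩ := hy.exists_thriceDiffOn hT
  obtain ⟨C, hC, stab⟩ := exists_stability_bound (T := T) h0 h1 hL
  have hM : 0 ≤ M := (abs_nonneg _).trans (hd.bound 0 ⟨le_rfl, hT.le⟩)
  have hCt := truncConst_pos h1
  refine ⟨C * (truncConst ν * (M + 1)), by positivity, ?_⟩
  intro N hN hstep ys hy0 hs1 hs2 hodd heven k _ hkN
  have hN1 : (1 : ℝ) ≤ N := by exact_mod_cast hN
  set h := T / (2 * (N : ℝ)) with hhd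
  have hh : 0 < h := by positivity
  have hNh : ((2 * N : ℕ) : ℝ) * h = T := by
    rw [hhd]; push_cast; field_simp
  have hNR : (2 : ℝ) ≤ (2 * N : ℕ) := by push_cast; linarith
  have hκ : L * h ^ ν ≤ 1 / 216 := by
    calc L * h ^ ν ≤ L * (1 / (216 * L)) := by gcongr
      _ = 1 / 216 := by field_simp
  have hY := hd.comp_mul hh hNh.le
  set η := truncConst ν * (h ^ 3 * M)
  have hη : 0 ≤ η := by positivity
  have hx : ∀ n : ℝ, 0 < n → n ≤ (2 * N : ℕ) → n * h ∈ Set.Ioc 0 T := fun n hn hnN =>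
    ⟨by positivity, by rw [← hNh]; gcongr⟩
  have hrow : ∀ (n : ℝ) (v S D : ℝ), 0 < n → n ≤ (2 * N : ℕ) →
      |kernelIntegral ν n (fun t => h * y1 (t * h)) 0 n - S| ≤ η →
      h ^ (-ν) * D = f (n * h) v → |S - D| ≤ L * h ^ ν * |y (n * h) - v| + η := by
    intro n v S D hn hnN htr hsch
    have hmem := hx n hn hnN
    refine row_error hh htr ?_ hsch (hf _ (Set.Ioc_subset_Icc_self hmem) _ _)
    rw [← caputo_eq_kernelIntegral hn.le hh hmem.2 hd.first]
    exact hode _ hmem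
  set e : ℕ → ℝ := fun j => y ((j : ℝ) * h) - ys j with he
  have he0 : e 0 = 0 := by simp [he, hy0]
  have key := stab (2 * N) h η e hh hNh.le hκ hη he0 ?_ ?_ ?_ ?_ k hkN
  · calc |y ((k : ℝ) * h) - ys k| ≤ C * (η / h ^ ν) := key
      _ = C * (truncConst ν * M) * (h ^ 3 / h ^ ν) := by ring
      _ = C * (truncConst ν * M) * h ^ (3 - ν) := by
        rw [Real.rpow_sub hh, ← Real.rpow_natCast h 3]; norm_num
      _ ≤ C * (truncConst ν * (M + 1)) * h ^ (3 - ν) := by gcongr; linarith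
  · have := hrow 1 (ys 1) _ (Dhat0 ν * ys 0 + Dhat1 ν * ys 1 + Dhat2 ν * ys 2) one_pos
      (by linarith) (truncation_one h0 h1 hY hNR) (by rwa [one_mul])
    convert this using 2
    · simp only [he, Nat.cast_one, Nat.cast_ofNat, zero_mul, hy0]; ring
    · simp [he]
  · have := hrow 2 (ys 2) _ (Dtil0 ν * ys 0 + Dtil1 ν * ys 1 + Dtil2 ν * ys 2) two_pos
      hNR (truncation_two h0 h1 hY hNR) hs2
    convert this using 2
    · simp only [he, Nat.cast_one, Nat.cast_ofNat, zero_mul, hy0]; ring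
    · simp [he]
  · intro m hm hmN
    have hmN' : ((2 * m + 1 : ℕ) : ℝ) ≤ (2 * N : ℕ) := by exact_mod_cast hmN
    have := hrow _ _ _ _ (by positivity) hmN' (truncation_odd h0 h1 hY hm hmN') (hodd m hm hmN)
    convert this using 2
    simp only [he, mul_sub, sum_sub_distrib]; ring
  · intro m hm hmN
    have hmN' : ((2 * m + 2 : ℕ) : ℝ) ≤ (2 * N : ℕ) := by exact_mod_cast hmN
    have := hrow _ _ _ _ (by positivity) hmN' (truncation_even h0 h1 hY hmN') (heven m hm hmN)
    convert this using 2
    simp only [he, mul_sub, sum_sub_distrib]; ring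
end

section
/- For every ν ∈ (0,1) and every integer k ≥ 2, it holds that (1 − 1/k)^{2−ν} − (1 + 1/k)^{2−ν} ≥ −2(2−ν)/k + (2−ν)(1−ν)ν/(3k³). -/
/-- A function on `[0, 1)` vanishing at `0` with nonnegative derivative is nonnegative. -/
lemma nonneg_of_hasDerivAt_nonneg {f f' : ℝ → ℝ}
    (hf : ∀ x ∈ Set.Ico (0 : ℝ) 1, HasDerivAt f (f' x) x)
    (hf' : ∀ x ∈ Set.Ico (0 : ℝ) 1, 0 ≤ f' x) (h0 : f 0 = 0) :
    ∀ x ∈ Set.Ico (0 : ℝ) 1, 0 ≤ f x := by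
  intro x hx
  have hmono : MonotoneOn f (Set.Ico 0 1) := by
    refine monotoneOn_of_hasDerivWithinAt_nonneg (convex_Ico 0 1)
      (fun y hy => (hf y hy).continuousAt.continuousWithinAt)
      (fun y hy => (hf y (interior_subset hy)).hasDerivWithinAt)
      (fun y hy => hf' y (interior_subset hy))
  simpa [h0] using hmono (Set.left_mem_Ico.2 one_pos) hx hx.1

lemma hasDerivAt_one_sub_rpow (p : ℝ) {x : ℝ} (hx : x ∈ Set.Ico (0 : ℝ) 1) :
    HasDerivAt (fun y : ℝ => (1 - y) ^ p) (-(p * (1 - x) ^ (p - 1))) x := by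
  have h := ((hasDerivAt_id' x).const_sub 1).rpow_const (p := p)
    (Or.inl (sub_pos.2 hx.2).ne')
  convert h using 1
  ring

lemma hasDerivAt_one_add_rpow (p : ℝ) {x : ℝ} (hx : x ∈ Set.Ico (0 : ℝ) 1) :
    HasDerivAt (fun y : ℝ => (1 + y) ^ p) (p * (1 + x) ^ (p - 1)) x := by
  have h := ((hasDerivAt_id' x).const_add 1).rpow_const (p := p)
    (Or.inl (by have := hx.1; positivity))
  convert h using 1
  ring

lemma two_le_one_sub_rpow_add_one_add_rpow {p : ℝ} (hp : p ≤ 0) {x : ℝ}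
    (hx : x ∈ Set.Ico (0 : ℝ) 1) : 2 ≤ (1 - x) ^ p + (1 + x) ^ p := by
  obtain ⟨h0, h1⟩ := hx
  have hprod : 1 ≤ (1 - x) ^ p * (1 + x) ^ p := by
    rw [← Real.mul_rpow (by linarith) (by linarith)]
    exact Real.one_le_rpow_of_pos_of_le_one_of_nonpos (by nlinarith) (by nlinarith) hp
  have hsub : 0 < (1 - x) ^ p := Real.rpow_pos_of_pos (by linarith) p
  have hadd : 0 < (1 + x) ^ p := Real.rpow_pos_of_pos (by linarith) p
  nlinarith [sq_nonneg ((1 - x) ^ p - (1 + x) ^ p)]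

lemma two_mul_le_one_sub_rpow_sub_one_add_rpow {ν : ℝ} (hν : 0 ≤ ν) :
    ∀ x ∈ Set.Ico (0 : ℝ) 1, 0 ≤ (1 - x) ^ (-ν) - (1 + x) ^ (-ν) - 2 * ν * x := by
  refine nonneg_of_hasDerivAt_nonneg (fun x hx =>
    ((hasDerivAt_one_sub_rpow (-ν) hx).sub (hasDerivAt_one_add_rpow (-ν) hx)).sub
      ((hasDerivAt_id x).const_mul (2 * ν))) (fun x hx => ?_) (by simp)
  have h := two_le_one_sub_rpow_add_one_add_rpow (p := -ν - 1) (by linarith) hx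
  linarith [mul_nonneg hν (sub_nonneg.2 h)]

lemma one_sub_rpow_add_one_add_rpow_le {ν : ℝ} (hν : 0 ≤ ν) (hν' : ν ≤ 1) :
    ∀ x ∈ Set.Ico (0 : ℝ) 1,
      0 ≤ 2 - ((1 - x) ^ (1 - ν) + (1 + x) ^ (1 - ν)) - (1 - ν) * ν * x ^ 2 := by
  refine nonneg_of_hasDerivAt_nonneg (fun x hx =>
    (((hasDerivAt_one_sub_rpow (1 - ν) hx).add
      (hasDerivAt_one_add_rpow (1 - ν) hx)).const_sub 2).sub
      ((hasDerivAt_pow 2 x).const_mul ((1 - ν) * ν))) (fun x hx => ?_) (by norm_num)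
  have h := mul_nonneg (sub_nonneg.2 hν') (two_mul_le_one_sub_rpow_sub_one_add_rpow hν x hx)
  rw [show 1 - ν - 1 = -ν by ring]
  norm_num
  linarith

lemma one_sub_rpow_sub_one_add_rpow_ge {ν : ℝ} (hν : 0 ≤ ν) (hν' : ν ≤ 1) :
    ∀ x ∈ Set.Ico (0 : ℝ) 1,
      0 ≤ (1 - x) ^ (2 - ν) - (1 + x) ^ (2 - ν) + 2 * (2 - ν) * x
        - (2 - ν) * (1 - ν) * ν / 3 * x ^ 3 := by
  refine nonneg_of_hasDerivAt_nonneg (fun x hx =>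
    (((hasDerivAt_one_sub_rpow (2 - ν) hx).sub (hasDerivAt_one_add_rpow (2 - ν) hx)).add
      ((hasDerivAt_id x).const_mul (2 * (2 - ν)))).sub
      ((hasDerivAt_pow 3 x).const_mul ((2 - ν) * (1 - ν) * ν / 3))) (fun x hx => ?_) (by simp)
  have h := mul_nonneg (show 0 ≤ 2 - ν by linarith)
    (one_sub_rpow_add_one_add_rpow_le hν hν' x hx)
  rw [show 2 - ν - 1 = 1 - ν by ring]
  norm_num
  linarith

theorem stmt17 (ν : ℝ) (hν : ν ∈ Set.Ioo (0:ℝ) 1) (k : ℕ) (hk : 2 ≤ k) :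
    (1 - 1 / (k : ℝ)) ^ (2 - ν) - (1 + 1 / (k : ℝ)) ^ (2 - ν)
      ≥ -2 * (2 - ν) / (k : ℝ) + (2 - ν) * (1 - ν) * ν / (3 * (k : ℝ) ^ 3) := by
  have hk' : (2 : ℝ) ≤ k := by exact_mod_cast hk
  have hx : 1 / (k : ℝ) ∈ Set.Ico (0 : ℝ) 1 :=
    ⟨by positivity, by rw [div_lt_one (by linarith)]; linarith⟩
  have h := one_sub_rpow_sub_one_add_rpow_ge hν.1.le hν.2.le _ hx
  have e : -2 * (2 - ν) / (k : ℝ) + (2 - ν) * (1 - ν) * ν / (3 * (k : ℝ) ^ 3)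
      = -(2 * (2 - ν) * (1 / (k : ℝ))) + (2 - ν) * (1 - ν) * ν / 3 * (1 / (k : ℝ)) ^ 3 := by
    field_simp
  rw [e]
  linarith
end

section
/- For every ν ∈ (0,1), it holds that 12 − ν² − (12 + 8ν + ν²)·2^{−ν} > (1/16)·(2+ν)(2−ν)(1−ν)ν. -/
theorem stmt18 (ν : ℝ) (hν : ν ∈ Set.Ioo (0:ℝ) 1) :
    12 - ν ^ 2 - (12 + 8 * ν + ν ^ 2) * (2 : ℝ) ^ (-ν)
      > (1 / 16) * (2 + ν) * (2 - ν) * (1 - ν) * ν := by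
  obtain ⟨h0, h1⟩ := hν
  have hlog : 0.693 * ν ≤ Real.log 2 * ν := by
    have := Real.log_two_gt_d9
    gcongr
    linarith
  have hexp : 1 + 0.693 * ν + (0.693 * ν) ^ 2 / 2 ≤ (2 : ℝ) ^ ν := by
    rw [Real.rpow_def_of_pos two_pos]
    exact (Real.quadratic_le_exp_of_nonneg (by positivity)).trans (Real.exp_le_exp.2 hlog)
  have hN : 0 < 12 - ν ^ 2 - (1 / 16) * (2 + ν) * (2 - ν) * (1 - ν) * ν := by
    nlinarith [mul_pos h0 (sub_pos.2 h1), mul_pos (mul_pos h0 h0) (mul_pos h0 (sub_pos.2 h1))]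
  have hpoly : 12 + 8 * ν + ν ^ 2 <
      (12 - ν ^ 2 - (1 / 16) * (2 + ν) * (2 - ν) * (1 - ν) * ν) *
        (1 + 0.693 * ν + (0.693 * ν) ^ 2 / 2) := by
    have h2 : 0 < ν ^ 2 := by positivity
    have h3 : ν ^ 3 < ν ^ 2 := by nlinarith
    have h4 : ν ^ 4 < ν ^ 2 := by nlinarith
    have h5 : 0 < ν ^ 5 := by positivity
    have h6 : ν ^ 6 < ν ^ 2 := by nlinarith
    nlinarith
  have hlt := hpoly.trans_le (mul_le_mul_of_nonneg_left hexp hN.le)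
  rw [Real.rpow_neg two_pos.le, ← div_eq_mul_inv]
  have := (div_lt_iff₀ (Real.rpow_pos_of_pos two_pos ν)).2 hlt
  linarith
end
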